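/- arXiv:2512.02784 — 5 statements merged into one kernel-verified Lean document; each statement's English description precedes it below -/
import Mathlib

section
/- Let m, d, k ≥ 1. If there exists a nonsingular bilinear map f : ℝ^m × ℝ^d → ℝ^k, then for every integer j with k − d < j < m and 0 ≤ j ≤ k, the binomial coefficient C(k, j) is even. -/
noncomputable section

/-- A map `f : E → F → G` of `K`-modules is bilinear. -/
def IsBilin (K : Type*) [Field K] {E F G : Type*} [AddCommGroup E] [AddCommGroup F]
    [AddCommGroup G] [Module K E] [Module K F] [Module K G] (f : E → F → G) : Prop :=
  (∀ x x' y, f (x + x') y = f x y + f x' y) ∧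
  (∀ (c : K) x y, f (c • x) y = c • f x y) ∧
  (∀ x y y', f x (y + y') = f x y + f x y') ∧
  (∀ (c : K) x y, f x (c • y) = c • f x y)

/-- A map `f : E → F → G` is nonsingular if `f x y = 0` implies `x = 0` or `y = 0`. -/
def Nonsingular {E F G : Type*} [Zero E] [Zero F] [Zero G] (f : E → F → G) : Prop :=
  ∀ x y, f x y = 0 → x = 0 ∨ y = 0

/-- `g_K(d)`: the smallest `k` for which there exists a nonsingular bilinear map
`K^d × K^d → K^k`. -/
def gBil (K : Type*) [Field K] (d : ℕ) : ℕ :=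
  sInf {k | ∃ f : (Fin d → K) → (Fin d → K) → (Fin k → K), IsBilin K f ∧ Nonsingular f}

section NonsingularBilinear

open Module

/-- Multiplication by `z` induces a surjection `S / D → (A + z S) / A` as soon as `z D ⊆ A`. -/
theorem finrank_sup_span_mul_add_le {K P : Type*} [Field K] [CommRing P] [Algebra K P]
    {A D S : Submodule K P} [FiniteDimensional K A] [FiniteDimensional K S]
    (z : P) (hDS : D ≤ S) (hz : Submodule.span K {z} * D ≤ A) :
    finrank K ↥(A ⊔ Submodule.span K {z} * S) + finrank K D ≤ finrank K A + finrank K S := by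
  set g : S →ₗ[K] P ⧸ A := A.mkQ ∘ₗ LinearMap.mulLeft K z ∘ₗ S.subtype with hg
  have hsup : A ⊔ Submodule.span K {z} * S = (LinearMap.range g).comap A.mkQ := by
    have : LinearMap.range g = (Submodule.span K {z} * S).map A.mkQ := by
      rw [hg, LinearMap.range_comp, LinearMap.range_comp, Submodule.range_subtype]
      congr 1
      ext x
      simp [Submodule.mem_span_singleton_mul]
    rw [this, Submodule.comap_map_mkQ]
  have hker : D.comap S.subtype ≤ LinearMap.ker g := by
    intro x hx
    rw [LinearMap.mem_ker, hg]
    simp only [LinearMap.comp_apply, Submodule.mkQ_apply, Submodule.Quotient.mk_eq_zero]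
    exact hz (Submodule.mul_mem_mul (Submodule.mem_span_singleton_self z) hx)
  have h1 : finrank K (D.comap S.subtype) = finrank K D :=
    (Submodule.comapSubtypeEquivOfLe hDS).finrank_eq
  have h2 := Submodule.finrank_mono hker
  have h3 := g.finrank_range_add_finrank_ker
  have h4 : finrank K ↥(A ⊔ Submodule.span K {z} * S) ≤
      finrank K A + finrank K (LinearMap.range g) := by
    rw [hsup]
    set h : (LinearMap.range g).comap A.mkQ →ₗ[K] P ⧸ A := A.mkQ ∘ₗ Submodule.subtype _ with hh
    have : FiniteDimensional K ↥((LinearMap.range g).comap A.mkQ) := by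
      rw [← hsup]
      have : FiniteDimensional K ↥(Submodule.span K {z} * S) := by
        rw [← Submodule.fg_iff_finiteDimensional]
        exact (Submodule.fg_span_singleton z).mul ((Submodule.fg_iff_finiteDimensional S).2 ‹_›)
      infer_instance
    have e1 := h.finrank_range_add_finrank_ker
    have e2 : finrank K (LinearMap.range h) ≤ finrank K (LinearMap.range g) := by
      apply Submodule.finrank_mono
      rintro _ ⟨x, rfl⟩
      exact x.2
    have e3 : finrank K (LinearMap.ker h) ≤ finrank K A := by
      have : LinearMap.ker h ≤ A.comap (Submodule.subtype _) := by
        intro x hx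
        simpa [hh] using hx
      refine (Submodule.finrank_mono this).trans ?_
      refine (Submodule.comapSubtypeEquivOfLe ?_).finrank_eq.le
      rw [← hsup]
      exact le_sup_left
    omega
  omega

/-- A generic member of the pencil `β + s α` has rank at least that of `α`. -/
theorem finite_setOf_finrank_range_add_smul_lt {K V W : Type*} [Field K] [AddCommGroup V]
    [Module K V] [FiniteDimensional K V] [AddCommGroup W] [Module K W] (α β : V →ₗ[K] W) :
    {s : K | finrank K (LinearMap.range (β + s • α)) < finrank K (LinearMap.range α)}.Finite := by
  obtain ⟨C, hC⟩ := Submodule.exists_isCompl (LinearMap.ker α)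
  have hinj : LinearMap.ker (α ∘ₗ C.subtype) = ⊥ := by
    rw [LinearMap.ker_eq_bot']
    intro x hx
    have : (x : V) ∈ LinearMap.ker α ⊓ C := ⟨hx, x.2⟩
    rw [hC.inf_eq_bot] at this
    simpa using this
  obtain ⟨g, hg⟩ := LinearMap.exists_leftInverse_of_injective _ hinj
  have hfin := Module.End.finite_hasEigenvalue (g ∘ₗ β ∘ₗ C.subtype)
  refine (hfin.preimage (f := fun s : K => -s) neg_injective.injOn).subset ?_
  intro s hs
  by_contra hns
  refine absurd (Set.mem_ofPred.1 hs) (not_lt.2 ?_)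
  have hi : Function.Injective ((β + s • α) ∘ₗ C.subtype) := by
    rw [← LinearMap.ker_eq_bot, LinearMap.ker_eq_bot']
    intro x hx
    by_contra hx0
    apply hns
    refine Module.End.hasEigenvalue_of_hasEigenvector (x := x) ⟨?_, hx0⟩
    rw [Module.End.mem_eigenspace_iff]
    have h1 : g (((β + s • α) ∘ₗ C.subtype) x) = 0 := by rw [hx, map_zero]
    have h2 : g (α x) = x := LinearMap.congr_fun hg x
    simp only [LinearMap.comp_apply, LinearMap.add_apply, LinearMap.smul_apply, map_add, map_smul,
      Submodule.subtype_apply, h2] at h1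
    rw [LinearMap.comp_apply, LinearMap.comp_apply, Submodule.subtype_apply, neg_smul]
    exact eq_neg_of_add_eq_zero_left h1
  have e1 := LinearMap.finrank_range_of_inj hi
  have e2 := Submodule.finrank_mono (LinearMap.range_comp_le_range C.subtype (β + s • α))
  have e3 := Submodule.finrank_add_eq_of_isCompl hC
  have e4 := α.finrank_range_add_finrank_ker
  omega

theorem exists_isRoot_of_monic_of_odd_natDegree {p : Polynomial ℝ} (hm : p.Monic)
    (ho : Odd p.natDegree) : ∃ x, p.IsRoot x := by
  have hpos : 0 < p.degree := Polynomial.natDegree_pos_iff_degree_pos.1 ho.pos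
  have htop := p.tendsto_atTop_of_leadingCoeff_nonneg hpos
    (by rw [hm.leadingCoeff]; exact zero_le_one)
  set q := p.comp (-Polynomial.X) with hq
  have hqd : q.natDegree = p.natDegree := by
    rw [hq, Polynomial.natDegree_comp, Polynomial.natDegree_neg, Polynomial.natDegree_X, mul_one]
  have hql : q.leadingCoeff = -1 := by
    rw [hq, Polynomial.leadingCoeff_comp (by simp), hm.leadingCoeff]
    simp [ho.neg_one_pow]
  have hbot := q.tendsto_atBot_of_leadingCoeff_nonpos
    (Polynomial.natDegree_pos_iff_degree_pos.1 (hqd ▸ ho.pos)) (by rw [hql]; norm_num)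
  have hbot' : Filter.Tendsto (fun x => p.eval x) Filter.atBot Filter.atBot := by
    have := hbot.comp Filter.tendsto_neg_atBot_atTop
    refine this.congr fun x => ?_
    simp [hq]
  exact p.continuous.surjective htop hbot' 0

theorem exists_hasEigenvalue_of_odd_finrank {V : Type*} [AddCommGroup V] [Module ℝ V]
    (hodd : Odd (finrank ℝ V)) (T : End ℝ V) : ∃ c, T.HasEigenvalue c := by
  have : FiniteDimensional ℝ V := FiniteDimensional.of_finrank_pos hodd.pos
  obtain ⟨c, hc⟩ := exists_isRoot_of_monic_of_odd_natDegree T.charpoly_monic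
    (by rwa [LinearMap.charpoly_natDegree])
  exact ⟨c, (Module.End.hasEigenvalue_iff_isRoot_charpoly T c).2 hc⟩

/-- A commuting family of endomorphisms of an odd-dimensional real vector space has a common
eigenvector. -/
theorem exists_common_eigenvector_of_odd_finrank {ι V : Type*} [AddCommGroup V] [Module ℝ V]
    (hodd : Odd (finrank ℝ V)) (T : ι → End ℝ V) (hT : ∀ i j, Commute (T i) (T j)) :
    ∃ v ≠ 0, ∃ c : ι → ℝ, ∀ i, T i v = c i • v := by
  have : FiniteDimensional ℝ V := FiniteDimensional.of_finrank_pos hodd.pos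
  have hex : ∃ d, ∃ N : Submodule ℝ V, finrank ℝ N = d ∧ Odd d ∧ ∀ i, ∀ x ∈ N, T i x ∈ N :=
    ⟨_, ⊤, rfl, by rwa [finrank_top], fun _ _ _ => trivial⟩
  classical
  obtain ⟨N, hN, hNodd, hinv⟩ := Nat.find_spec hex
  have hmin : ∀ N' : Submodule ℝ V, N' ≤ N → Odd (finrank ℝ N') →
      (∀ i, ∀ x ∈ N', T i x ∈ N') → N' = N := by
    intro N' hle ho hi
    refine Submodule.eq_of_le_of_finrank_le hle ?_
    rw [hN]
    exact Nat.find_min' hex ⟨N', rfl, ho, hi⟩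
  have hscalar : ∀ i, ∃ c : ℝ, ∀ x ∈ N, T i x = c • x := by
    intro i
    obtain ⟨c, hc⟩ := exists_hasEigenvalue_of_odd_finrank (hN ▸ hNodd) ((T i).restrict (hinv i))
    obtain ⟨w, hw⟩ := hc.exists_hasEigenvector
    refine ⟨c, ?_⟩
    set g : N →ₗ[ℝ] V := (T i - c • LinearMap.id) ∘ₗ N.subtype with hg
    have hgw : g w = 0 := by
      have := congrArg Subtype.val hw.apply_eq_smul
      simpa [hg, sub_eq_zero] using this
    have hcomm : ∀ j (x : N), g ⟨T j x, hinv j x x.2⟩ = T j (g x) := by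
      intro j x
      have := LinearMap.congr_fun (hT i j).eq x.1
      simp only [Module.End.mul_apply] at this
      simp [hg, this]
    have hsum := g.finrank_range_add_finrank_ker
    rw [hN] at hsum
    have hkerV : finrank ℝ ((LinearMap.ker g).map N.subtype) = finrank ℝ (LinearMap.ker g) :=
      Submodule.finrank_map_subtype_eq _ _
    rcases Nat.even_or_odd (finrank ℝ (LinearMap.range g)) with he | ho
    · have hk : (LinearMap.ker g).map N.subtype = N := by
        apply hmin
        · rintro _ ⟨x, -, rfl⟩
          exact x.2
        · rw [hkerV]
          rw [← hsum] at hNodd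
          exact (Nat.odd_add'.1 hNodd).2 he
        · rintro j _ ⟨x, hx, rfl⟩
          refine ⟨⟨T j x, hinv j x x.2⟩, ?_, rfl⟩
          rw [SetLike.mem_coe, LinearMap.mem_ker] at hx ⊢
          rw [hcomm, hx, map_zero]
      intro x hx
      rw [← hk] at hx
      obtain ⟨y, hy, rfl⟩ := hx
      have hy' : g y = 0 := hy
      simpa [hg, sub_eq_zero] using hy'
    · have hr : LinearMap.range g = N := by
        apply hmin
        · rintro _ ⟨x, rfl⟩
          exact N.sub_mem (hinv i x x.2) (N.smul_mem c x.2)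
        · exact ho
        · rintro j _ ⟨x, rfl⟩
          exact ⟨_, hcomm j x⟩
      rw [hr, hN] at hsum
      have h0 : LinearMap.ker g = ⊥ := Submodule.finrank_eq_zero.1 (by omega)
      have : w ∈ LinearMap.ker g := hgw
      rw [h0, Submodule.mem_bot] at this
      exact absurd this hw.2
  choose c hc using hscalar
  have : Nontrivial N := Module.nontrivial_of_finrank_pos (R := ℝ) (hN ▸ hNodd.pos)
  obtain ⟨v, hv⟩ := exists_ne (0 : N)
  exact ⟨v, by simpa using hv, c, fun i => hc i v v.2⟩

/-- A common eigenvector, relative to `Z₀`, for a family of maps `V₀ → V₁` that commute in the sense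
that their two-fold products into `V₂` agree. -/
theorem exists_common_relative_eigenvector {ι V₀ V₁ V₂ : Type*} [AddCommGroup V₀] [Module ℝ V₀]
    [AddCommGroup V₁] [Module ℝ V₁] [AddCommGroup V₂] [Module ℝ V₂] (hodd : Odd (finrank ℝ V₀))
    (Z₀ : V₀ ≃ₗ[ℝ] V₁) (Z₁ : V₁ →ₗ[ℝ] V₂) (hZ₁ : Function.Injective Z₁) (W₀ : ι → V₀ →ₗ[ℝ] V₁)
    (W₁ : ι → V₁ →ₗ[ℝ] V₂) (hW : ∀ i j x, W₁ i (W₀ j x) = W₁ j (W₀ i x))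
    (hWZ : ∀ i x, W₁ i (Z₀ x) = Z₁ (W₀ i x)) :
    ∃ v ≠ 0, ∃ c : ι → ℝ, ∀ i, W₀ i v = c i • Z₀ v := by
  obtain ⟨v, hv, c, hc⟩ := exists_common_eigenvector_of_odd_finrank hodd
    (fun i => Z₀.symm.toLinearMap ∘ₗ W₀ i) (by
      intro i j
      ext x
      simp only [Module.End.mul_apply, LinearMap.comp_apply, LinearEquiv.coe_coe]
      apply Z₀.injective
      apply hZ₁
      rw [LinearEquiv.apply_symm_apply, LinearEquiv.apply_symm_apply, ← hWZ, ← hWZ,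
        LinearEquiv.apply_symm_apply, LinearEquiv.apply_symm_apply, hW])
  refine ⟨v, hv, c, fun i => ?_⟩
  have := congrArg Z₀ (hc i)
  simpa using this

section Bigraded

variable {K P : Type*} [Field K] [CommRing P] [Algebra K P]

/-- The power `L ^ (p - 1)`, read as `⊥` for `p = 0`. -/
def predPow (L : Submodule K P) : ℕ → Submodule K P
  | 0 => ⊥
  | p + 1 => L ^ p

/-- The piece of bidegree `(p, q)` of the ideal generated by `X`, `Y`, `Z`, whose elements have
bidegrees `(1, 0)`, `(0, 1)`, `(1, 1)`, inside the bigraded ring generated by `Lx` and `Ly`. -/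
def idealPiece (Lx Ly X Y Z : Submodule K P) (p q : ℕ) : Submodule K P :=
  X * predPow Lx p * Ly ^ q + Y * Lx ^ p * predPow Ly q + Z * predPow Lx p * predPow Ly q

theorem mul_predPow_le (L X : Submodule K P) (hX : X ≤ L) (p : ℕ) : X * predPow L p ≤ L ^ p := by
  cases p with
  | zero => simp [predPow]
  | succ p =>
    rw [pow_succ']
    exact mul_le_mul_left hX _

theorem mul_predPow_le_succ (L X : Submodule K P) (hX : X ≤ L) (p : ℕ) :
    X * predPow L p ≤ predPow L (p + 1) :=
  mul_predPow_le L X hX p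

theorem idealPiece_le {Lx Ly X Y Z : Submodule K P} (hX : X ≤ Lx) (hY : Y ≤ Ly) (hZ : Z ≤ Lx * Ly)
    (p q : ℕ) : idealPiece Lx Ly X Y Z p q ≤ Lx ^ p * Ly ^ q := by
  refine sup_le (sup_le ?_ ?_) ?_
  · exact mul_le_mul_left (mul_predPow_le _ _ hX _) _
  · calc Y * Lx ^ p * predPow Ly q = Lx ^ p * (Y * predPow Ly q) := by ring
      _ ≤ _ := mul_le_mul_right (mul_predPow_le _ _ hY _) _
  · calc Z * predPow Lx p * predPow Ly q ≤ Lx * Ly * predPow Lx p * predPow Ly q := by gcongr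
      _ = (Lx * predPow Lx p) * (Ly * predPow Ly q) := by ring
      _ ≤ _ := mul_le_mul' (mul_predPow_le _ _ le_rfl _) (mul_predPow_le _ _ le_rfl _)

theorem fg_idealPiece {Lx Ly X Y Z : Submodule K P} (hLx : Lx.FG) (hLy : Ly.FG) (hX : X ≤ Lx)
    (hY : Y ≤ Ly) (hZ : Z ≤ Lx * Ly) (p q : ℕ) : (idealPiece Lx Ly X Y Z p q).FG := by
  have h := (hLx.pow p).mul (hLy.pow q)
  rw [Submodule.fg_iff_finiteDimensional] at h ⊢
  exact Submodule.finiteDimensional_of_le (idealPiece_le hX hY hZ p q)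

theorem finrank_idealPiece_insert_mul {Lx Ly X Y Z : Submodule K P} (hLx : Lx.FG) (hLy : Ly.FG)
    (hX : X ≤ Lx) (hY : Y ≤ Ly) (hZ : Z ≤ Lx * Ly) {l m : P} (hl : l ∈ Lx) (hm : m ∈ Ly)
    (p q : ℕ) :
    finrank K (idealPiece Lx Ly (X ⊔ Submodule.span K {l}) Y Z (p + 1) q) +
        finrank K (idealPiece Lx Ly X (Y ⊔ Submodule.span K {m}) Z p q) ≤
      finrank K (idealPiece Lx Ly X Y (Z ⊔ Submodule.span K {l * m}) (p + 1) q) +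
        finrank K ↥(Lx ^ p * Ly ^ q) := by
  have hl' : Submodule.span K {l} ≤ Lx := by simpa
  have hm' : Submodule.span K {m} ≤ Ly := by simpa
  have hlm : Submodule.span K {l * m} = Submodule.span K {l} * Submodule.span K {m} := by
    rw [Submodule.span_mul_span, Set.singleton_mul_singleton]
  have hZ' : Z ⊔ Submodule.span K {l * m} ≤ Lx * Ly :=
    sup_le hZ (hlm.trans_le (mul_le_mul' hl' hm'))
  have := (Submodule.fg_iff_finiteDimensional _).1 (fg_idealPiece hLx hLy hX hY hZ' (p + 1) q)
  have := (Submodule.fg_iff_finiteDimensional _).1 ((hLx.pow p).mul (hLy.pow q))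
  have := (Submodule.fg_iff_finiteDimensional _).1
    ((Submodule.fg_span_singleton l).mul ((hLx.pow p).mul (hLy.pow q)))
  refine le_trans (Nat.add_le_add_right (Submodule.finrank_mono ?_) _)
    (finrank_sup_span_mul_add_le l (idealPiece_le hX (sup_le hY hm') hZ p q) ?_)
  · simp only [idealPiece, ← Submodule.add_eq_sup, predPow, add_mul]
    simp only [Submodule.add_eq_sup]
    refine sup_le (sup_le (sup_le ?_ ?_) ?_) ?_
    · exact le_sup_of_le_left (le_sup_of_le_left le_sup_left)
    · rw [mul_assoc]
      exact le_sup_right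
    · exact le_sup_of_le_left (le_sup_of_le_left le_sup_right)
    · exact le_sup_of_le_left (le_sup_of_le_right le_sup_left)
  · have hp := mul_predPow_le_succ Lx _ hl' p
    simp only [idealPiece, ← Submodule.add_eq_sup, add_mul, mul_add, hlm]
    simp only [Submodule.add_eq_sup]
    refine sup_le (sup_le ?_ (sup_le ?_ ?_)) ?_
    · refine le_sup_of_le_left (le_sup_of_le_left ?_)
      calc _ = X * (Submodule.span K {l} * predPow Lx p) * Ly ^ q := by ring
        _ ≤ _ := by gcongr
    · refine le_sup_of_le_left (le_sup_of_le_right ?_)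
      calc _ = Y * (Submodule.span K {l} * Lx ^ p) * predPow Ly q := by ring
        _ ≤ Y * (Lx * Lx ^ p) * predPow Ly q := by gcongr
        _ = _ := by ring
    · refine le_sup_of_le_right (le_sup_of_le_right (le_of_eq ?_))
      simp only [predPow]
      ring
    · refine le_sup_of_le_right (le_sup_of_le_left ?_)
      calc _ = Z * (Submodule.span K {l} * predPow Lx p) * predPow Ly q := by ring
        _ ≤ _ := by gcongr

theorem idealPiece_bot (Lx Ly X Y : Submodule K P) (p q : ℕ) :
    idealPiece Lx Ly X Y ⊥ p q = X * predPow Lx p * Ly ^ q ⊔ Y * Lx ^ p * predPow Ly q := by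
  simp [idealPiece]

theorem finrank_idealPiece_insert_left {Lx Ly X Y : Submodule K P} (hLx : Lx.FG) (hLy : Ly.FG)
    (hX : X ≤ Lx) (hY : Y ≤ Ly) {l : P} (hl : l ∈ Lx) (p q : ℕ) :
    finrank K (idealPiece Lx Ly (X ⊔ Submodule.span K {l}) Y ⊥ (p + 1) q) +
        finrank K (idealPiece Lx Ly X Y ⊥ p q) ≤
      finrank K (idealPiece Lx Ly X Y ⊥ (p + 1) q) + finrank K ↥(Lx ^ p * Ly ^ q) := by
  have hl' : Submodule.span K {l} ≤ Lx := by simpa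
  have := (Submodule.fg_iff_finiteDimensional _).1 (fg_idealPiece hLx hLy hX hY bot_le (p + 1) q)
  have := (Submodule.fg_iff_finiteDimensional _).1 ((hLx.pow p).mul (hLy.pow q))
  have := (Submodule.fg_iff_finiteDimensional _).1
    ((Submodule.fg_span_singleton l).mul ((hLx.pow p).mul (hLy.pow q)))
  refine le_trans (Nat.add_le_add_right (Submodule.finrank_mono ?_) _)
    (finrank_sup_span_mul_add_le l (idealPiece_le hX hY bot_le p q) ?_)
  · rw [idealPiece_bot, idealPiece_bot, Submodule.sup_mul, Submodule.sup_mul]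
    refine sup_le (sup_le ?_ ?_) ?_
    · exact le_sup_of_le_left le_sup_left
    · rw [mul_assoc]
      exact le_sup_right
    · exact le_sup_of_le_left le_sup_right
  · have hp := mul_predPow_le_succ Lx _ hl' p
    rw [idealPiece_bot, idealPiece_bot, Submodule.mul_sup]
    refine sup_le ?_ ?_
    · refine le_sup_of_le_left ?_
      calc _ = X * (Submodule.span K {l} * predPow Lx p) * Ly ^ q := by ring
        _ ≤ _ := by gcongr
    · refine le_sup_of_le_right ?_
      calc _ = Y * (Submodule.span K {l} * Lx ^ p) * predPow Ly q := by ring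
        _ ≤ Y * (Lx * Lx ^ p) * predPow Ly q := by gcongr
        _ = _ := by ring

theorem idealPiece_swap (Lx Ly X Y : Submodule K P) (p q : ℕ) :
    idealPiece Lx Ly X Y ⊥ p q = idealPiece Ly Lx Y X ⊥ q p := by
  rw [idealPiece_bot, idealPiece_bot, sup_comm]
  congr 1 <;> ring

theorem finrank_le_finrank_idealPiece_add {Lx Ly : Submodule K P} (hLx : Lx.FG) (hLy : Ly.FG)
    {l m : ℕ → P} {n k : ℕ} (hl : ∀ j, l j ∈ Lx) (hm : ∀ j, m j ∈ Ly)
    (hln : ∀ A : Finset ℕ, n ≤ A.card → Lx ≤ Submodule.span K (l '' A))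
    (hmk : ∀ B : Finset ℕ, k ≤ B.card → Ly ≤ Submodule.span K (m '' B)) (p q : ℕ) :
    ∀ (r t : ℕ) (A B : Finset ℕ), n ≤ A.card + r → k ≤ B.card + t →
      finrank K ↥(Lx ^ p * Ly ^ q) ≤
        finrank K (idealPiece Lx Ly (Submodule.span K (l '' A)) (Submodule.span K (m '' B)) ⊥ p q) +
          r.multichoose p * t.multichoose q := by
  have hlA : ∀ A : Finset ℕ, Submodule.span K (l '' A) ≤ Lx := fun A => by
    rw [Submodule.span_le]; rintro _ ⟨j, -, rfl⟩; exact hl j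
  have hmB : ∀ A : Finset ℕ, Submodule.span K (m '' A) ≤ Ly := fun A => by
    rw [Submodule.span_le]; rintro _ ⟨j, -, rfl⟩; exact hm j
  have hins : ∀ (g : ℕ → P) (A : Finset ℕ) (j : ℕ), Submodule.span K (g '' A) ⊔
      Submodule.span K {g j} = Submodule.span K (g '' ↑(insert j A)) := fun g A j => by
    rw [Finset.coe_insert, Set.image_insert_eq, Submodule.span_insert, sup_comm]
  induction p with
  | zero =>
    induction q with
    | zero =>
      intro r t A B _ _
      have : Lx ^ 0 * Ly ^ 0 = Submodule.span K {1} := by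
        rw [pow_zero, pow_zero, mul_one, Submodule.one_eq_span]
      rw [this]
      have := finrank_span_le_card (R := K) ({1} : Set P)
      simp only [Set.toFinset_singleton, Finset.card_singleton] at this
      rw [Nat.multichoose_zero_right, Nat.multichoose_zero_right]
      omega
    | succ q ihq =>
      intro r t
      induction t with
      | zero =>
        intro A B _ hB
        have : idealPiece Lx Ly (Submodule.span K (l '' A)) (Submodule.span K (m '' B)) ⊥ 0
            (q + 1) = Lx ^ 0 * Ly ^ (q + 1) := by
          refine le_antisymm (idealPiece_le (hlA A) (hmB B) bot_le _ _) ?_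
          refine le_sup_of_le_left (le_sup_of_le_right ?_)
          calc _ = Ly * Lx ^ 0 * Ly ^ q := by ring
            _ ≤ _ := by
              simp only [predPow]
              gcongr
              exact hmk B hB
        rw [this]
        exact Nat.le_add_right _ _
      | succ t iht =>
        intro A B hA hB
        obtain ⟨j, hj⟩ := Infinite.exists_notMem_finset B
        have h1 := iht A (insert j B) hA (by rw [Finset.card_insert_of_notMem hj]; omega)
        have h2 := ihq r (t + 1) A B hA hB
        have h3 := finrank_idealPiece_insert_left hLy hLx (hmB B) (hlA A) (hm j) q 0
        rw [← idealPiece_swap Lx Ly, ← idealPiece_swap Lx Ly, ← idealPiece_swap Lx Ly] at h3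
        rw [hins, mul_comm (Ly ^ q)] at h3
        rw [Nat.multichoose_succ_succ, mul_add]
        omega
  | succ p ihp =>
    intro r
    induction r with
    | zero =>
      intro t A B hA _
      have : idealPiece Lx Ly (Submodule.span K (l '' A)) (Submodule.span K (m '' B)) ⊥ (p + 1) q =
          Lx ^ (p + 1) * Ly ^ q := by
        refine le_antisymm (idealPiece_le (hlA A) (hmB B) bot_le _ _) ?_
        refine le_sup_of_le_left (le_sup_of_le_left ?_)
        rw [pow_succ']
        simp only [predPow]
        gcongr
        exact hln A hA
      rw [this]
      exact Nat.le_add_right _ _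
    | succ r ihr =>
      intro t A B hA hB
      obtain ⟨j, hj⟩ := Infinite.exists_notMem_finset A
      have h1 := ihr t (insert j A) B (by rw [Finset.card_insert_of_notMem hj]; omega) hB
      have h2 := ihp (r + 1) t A B hA hB
      have h3 := finrank_idealPiece_insert_left hLx hLy (hlA A) (hmB B) (hl j) p q
      rw [hins] at h3
      rw [Nat.multichoose_succ_succ, add_mul]
      omega

/-- The Hilbert function, in bidegree `(p, q)`, of the quotient of a polynomial ring in `n`
variables of bidegree `(1, 0)` and `m` of bidegree `(0, 1)` by `i` generic forms of bidegree `(1, 1)`,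
in the range where `p` and `q` are large compared with `i`. -/
def genericHilbert : ℕ → ℕ → ℕ → ℕ → ℕ → ℕ
  | 0, n, m, p, q => n.multichoose p * m.multichoose q
  | i + 1, n, m, p, q => genericHilbert i (n - 1) m p q + genericHilbert i n (m - 1) (p - 1) q

theorem genericHilbert_succ_succ (i : ℕ) : ∀ n m p q : ℕ, i + 1 ≤ p → i + 1 ≤ q →
    genericHilbert i n m (p + 1) (q + 1) =
      genericHilbert i n m p q + genericHilbert (i + 1) n m (p + 1) (q + 1) := by
  induction i with
  | zero =>
    intro n m p q hp hq
    obtain ⟨p, rfl⟩ := Nat.exists_eq_add_of_le' hp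
    obtain ⟨q, rfl⟩ := Nat.exists_eq_add_of_le' hq
    rcases n with _ | n <;> rcases m with _ | m <;>
      simp [genericHilbert, Nat.multichoose_succ_succ]
    ring
  | succ i ih =>
    intro n m p q hp hq
    obtain ⟨p, rfl⟩ := Nat.exists_eq_add_of_le' (show 1 ≤ p by omega)
    have h1 := ih (n - 1) m (p + 1) q (by omega) (by omega)
    have h2 := ih n (m - 1) p q (by omega) (by omega)
    rw [genericHilbert.eq_def (i + 1), genericHilbert.eq_def (i + 1), genericHilbert.eq_def (i + 2)]
    simp only [Nat.add_sub_cancel]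
    rw [h1, h2]
    ring

theorem genericHilbert_zero_left (i : ℕ) :
    ∀ m p q, i + 1 ≤ p → i + 1 ≤ q → genericHilbert i 0 m p q = 0 := by
  induction i with
  | zero =>
    intro m p q hp hq
    obtain ⟨p, rfl⟩ := Nat.exists_eq_add_of_le' hp
    simp [genericHilbert]
  | succ i ih =>
    intro m p q hp hq
    rw [genericHilbert, ih _ _ _ (by omega) (by omega), ih _ _ _ (by omega) (by omega)]

theorem genericHilbert_zero_right (i : ℕ) :
    ∀ n p q, i + 1 ≤ p → i + 1 ≤ q → genericHilbert i n 0 p q = 0 := by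
  induction i with
  | zero =>
    intro m p q hp hq
    obtain ⟨q, rfl⟩ := Nat.exists_eq_add_of_le' hq
    simp [genericHilbert]
  | succ i ih =>
    intro m p q hp hq
    rw [genericHilbert, ih _ _ _ (by omega) (by omega), ih _ _ _ (by omega) (by omega)]

theorem genericHilbert_eq_choose (i : ℕ) : ∀ n m p q, i = n + m → i + 1 ≤ p → i + 1 ≤ q →
    genericHilbert i (n + 1) (m + 1) p q = i.choose n := by
  induction i with
  | zero =>
    intro n m p q h hp hq
    obtain ⟨rfl, rfl⟩ : n = 0 ∧ m = 0 := by omega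
    simp [genericHilbert]
  | succ i ih =>
    intro n m p q h hp hq
    rw [genericHilbert, Nat.add_sub_cancel, Nat.add_sub_cancel]
    rcases n with _ | n
    · rw [genericHilbert_zero_left _ _ _ _ (by omega) (by omega)]
      obtain ⟨m, rfl⟩ := Nat.exists_eq_add_of_le' (show 1 ≤ m by omega)
      rw [ih 0 m _ _ (by omega) (by omega) (by omega)]
      simp
    · rw [ih n m _ _ (by omega) (by omega) (by omega), Nat.choose_succ_succ]
      rcases m with _ | m
      · rw [genericHilbert_zero_right _ _ _ _ (by omega) (by omega),
          Nat.choose_eq_zero_of_lt (show i < n + 1 by omega)]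
      · rw [ih (n + 1) m _ _ (by omega) (by omega) (by omega)]

theorem genericHilbert_eq_zero (i : ℕ) : ∀ n m p q, n + m ≤ i + 1 → i + 1 ≤ p → i + 1 ≤ q →
    genericHilbert i n m p q = 0 := by
  induction i with
  | zero =>
    intro n m p q h hp hq
    rcases n with _ | n
    · exact genericHilbert_zero_left _ _ _ _ hp hq
    · obtain rfl : m = 0 := by omega
      exact genericHilbert_zero_right _ _ _ _ hp hq
  | succ i ih =>
    intro n m p q h hp hq
    rcases n with _ | n
    · exact genericHilbert_zero_left _ _ _ _ hp hq
    · rcases m with _ | m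
      · exact genericHilbert_zero_right _ _ _ _ hp hq
      · rw [genericHilbert, ih _ _ _ _ (by omega) (by omega) (by omega),
          ih _ _ _ _ (by omega) (by omega) (by omega)]

theorem finrank_le_finrank_idealPiece_add_genericHilbert {Lx Ly : Submodule K P} (hLx : Lx.FG)
    (hLy : Ly.FG) {l m : ℕ → P} {n k : ℕ} (hl : ∀ j, l j ∈ Lx) (hm : ∀ j, m j ∈ Ly)
    (hln : ∀ A : Finset ℕ, n ≤ A.card → Lx ≤ Submodule.span K (l '' A))
    (hmk : ∀ B : Finset ℕ, k ≤ B.card → Ly ≤ Submodule.span K (m '' B)) (i : ℕ) :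
    ∀ (r t p q : ℕ) (A B : Finset ℕ), n ≤ A.card + r → k ≤ B.card + t →
      (∀ j ∈ A, i ≤ j) → (∀ j ∈ B, i ≤ j) → i ≤ p →
      finrank K ↥(Lx ^ p * Ly ^ q) ≤
        finrank K (idealPiece Lx Ly (Submodule.span K (l '' A)) (Submodule.span K (m '' B))
          (Submodule.span K ((fun j => l j * m j) '' Set.Iio i)) p q) +
          genericHilbert i r t p q := by
  have hlA : ∀ A : Finset ℕ, Submodule.span K (l '' A) ≤ Lx := fun A => by
    rw [Submodule.span_le]; rintro _ ⟨j, -, rfl⟩; exact hl j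
  have hmB : ∀ A : Finset ℕ, Submodule.span K (m '' A) ≤ Ly := fun A => by
    rw [Submodule.span_le]; rintro _ ⟨j, -, rfl⟩; exact hm j
  have hins : ∀ (g : ℕ → P) (A : Finset ℕ) (j : ℕ), Submodule.span K (g '' A) ⊔
      Submodule.span K {g j} = Submodule.span K (g '' ↑(insert j A)) := fun g A j => by
    rw [Finset.coe_insert, Set.image_insert_eq, Submodule.span_insert, sup_comm]
  induction i with
  | zero =>
    intro r t p q A B hA hB _ _ _
    have : Set.Iio 0 = (∅ : Set ℕ) := by ext; simp
    rw [this, Set.image_empty, Submodule.span_empty]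
    exact finrank_le_finrank_idealPiece_add hLx hLy hl hm hln hmk p q r t A B hA hB
  | succ i ih =>
    intro r t p q A B hA hB hAi hBi hp
    obtain ⟨p, rfl⟩ := Nat.exists_eq_add_of_le' (show 1 ≤ p by omega)
    have hiA : i ∉ A := fun h => by have := hAi i h; omega
    have hiB : i ∉ B := fun h => by have := hBi i h; omega
    have h1 := ih (r - 1) t (p + 1) q (insert i A) B
      (by rw [Finset.card_insert_of_notMem hiA]; omega) hB
      (by simp only [Finset.mem_insert, forall_eq_or_imp, le_refl, true_and]
          exact fun j hj => (Nat.le_succ i).trans (hAi j hj))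
      (fun j hj => (Nat.le_succ i).trans (hBi j hj)) (by omega)
    have h2 := ih r (t - 1) p q A (insert i B) hA
      (by rw [Finset.card_insert_of_notMem hiB]; omega)
      (fun j hj => (Nat.le_succ i).trans (hAi j hj))
      (by simp only [Finset.mem_insert, forall_eq_or_imp, le_refl, true_and]
          exact fun j hj => (Nat.le_succ i).trans (hBi j hj)) (by omega)
    have hZ : Submodule.span K ((fun j => l j * m j) '' Set.Iio i) ≤ Lx * Ly := by
      rw [Submodule.span_le]
      rintro _ ⟨j, -, rfl⟩
      exact Submodule.mul_mem_mul (hl j) (hm j)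
    have h3 := finrank_idealPiece_insert_mul hLx hLy (hlA A) (hmB B) hZ (hl i) (hm i) p q
    have hI : Submodule.span K ((fun j => l j * m j) '' Set.Iio i) ⊔ Submodule.span K {l i * m i} =
        Submodule.span K ((fun j => l j * m j) '' Set.Iio (i + 1)) := by
      have : Set.Iio (i + 1) = insert i (Set.Iio i) := by
        ext j
        simp only [Set.mem_Iio, Set.mem_insert_iff]
        omega
      rw [this, Set.image_insert_eq, Submodule.span_insert, sup_comm]
    rw [hins, hins, hI] at h3
    rw [genericHilbert, Nat.add_sub_cancel]
    omega

end Bigraded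

section Generic

variable {K P : Type*} [Field K] [CommRing P] [Algebra K P]

/-- Forms `f j` of bidegree `(1, 1)` spanning in each bidegree at least as much as the special forms
`l j * m j` do have the generic Hilbert function. -/
theorem finrank_eq_finrank_add_genericHilbert {Lx Ly : Submodule K P} (hLx : Lx.FG)
    (hLy : Ly.FG) {l m f : ℕ → P} {n k : ℕ} (hl : ∀ j, l j ∈ Lx) (hm : ∀ j, m j ∈ Ly)
    (hln : ∀ A : Finset ℕ, n ≤ A.card → Lx ≤ Submodule.span K (l '' A))
    (hmk : ∀ B : Finset ℕ, k ≤ B.card → Ly ≤ Submodule.span K (m '' B))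
    (hdim : ∀ p q, n.multichoose p * k.multichoose q ≤ finrank K ↥(Lx ^ p * Ly ^ q))
    (hf : ∀ j, f j ∈ Lx * Ly)
    (hle : ∀ i p q,
      finrank K ↥(Submodule.span K ((fun j => l j * m j) '' Set.Iio i) * (Lx ^ p * Ly ^ q)) ≤
        finrank K ↥(Submodule.span K (f '' Set.Iio i) * (Lx ^ p * Ly ^ q))) (i : ℕ) :
    ∀ p q, i ≤ p → i ≤ q → finrank K ↥(Lx ^ (p + 1) * Ly ^ (q + 1)) =
      finrank K ↥(Submodule.span K (f '' Set.Iio i) * (Lx ^ p * Ly ^ q)) +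
        genericHilbert i n k (p + 1) (q + 1) := by
  have hub : ∀ i p q, i ≤ p → finrank K ↥(Lx ^ (p + 1) * Ly ^ (q + 1)) ≤
      finrank K ↥(Submodule.span K (f '' Set.Iio i) * (Lx ^ p * Ly ^ q)) +
        genericHilbert i n k (p + 1) (q + 1) := by
    intro i p q hp
    have h := finrank_le_finrank_idealPiece_add_genericHilbert hLx hLy hl hm hln hmk i n k (p + 1)
      (q + 1) ∅ ∅ (by simp) (by simp) (by simp) (by simp) (by omega)
    have he : idealPiece Lx Ly (Submodule.span K (l '' (∅ : Finset ℕ)))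
        (Submodule.span K (m '' (∅ : Finset ℕ)))
        (Submodule.span K ((fun j => l j * m j) '' Set.Iio i)) (p + 1) (q + 1) =
        Submodule.span K ((fun j => l j * m j) '' Set.Iio i) * (Lx ^ p * Ly ^ q) := by
      simp [idealPiece, predPow, mul_assoc]
    rw [he] at h
    exact h.trans (Nat.add_le_add_right (hle i p q) _)
  induction i with
  | zero =>
    intro p q _ _
    refine le_antisymm (hub 0 p q (Nat.zero_le p)) ?_
    have : Set.Iio 0 = (∅ : Set ℕ) := by ext; simp
    rw [this, Set.image_empty, Submodule.span_empty, Submodule.bot_mul, finrank_bot, zero_add]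
    exact hdim _ _
  | succ i ih =>
    intro p q hp hq
    refine le_antisymm (hub (i + 1) p q hp) ?_
    have hg := genericHilbert_succ_succ i n k p q hp hq
    have h1 := ih p q (by omega) (by omega)
    obtain ⟨p, rfl⟩ := Nat.exists_eq_add_of_le' (show 1 ≤ p by omega)
    obtain ⟨q, rfl⟩ := Nat.exists_eq_add_of_le' (show 1 ≤ q by omega)
    have h2 := ih p q (by omega) (by omega)
    set J := Submodule.span K (f '' Set.Iio i) with hJ
    have hJle : J ≤ Lx * Ly := by
      rw [hJ, Submodule.span_le]
      rintro _ ⟨j, -, rfl⟩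
      exact hf j
    have hfi : Submodule.span K {f i} ≤ Lx * Ly := by simpa using hf i
    have hJfg : J.FG := Submodule.fg_span ((Set.finite_Iio i).image f)
    have := (Submodule.fg_iff_finiteDimensional _).1 ((hLx.pow (p + 1)).mul (hLy.pow (q + 1)))
    have := (Submodule.fg_iff_finiteDimensional _).1
      (hJfg.mul ((hLx.pow (p + 1)).mul (hLy.pow (q + 1))))
    have h3 := finrank_sup_span_mul_add_le (A := J * (Lx ^ (p + 1) * Ly ^ (q + 1)))
      (D := J * (Lx ^ p * Ly ^ q)) (S := Lx ^ (p + 1) * Ly ^ (q + 1)) (f i)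
      (calc J * (Lx ^ p * Ly ^ q) ≤ (Lx * Ly) * (Lx ^ p * Ly ^ q) := by gcongr
        _ = _ := by ring)
      (calc _ = J * (Submodule.span K {f i} * (Lx ^ p * Ly ^ q)) := by ring
        _ ≤ J * ((Lx * Ly) * (Lx ^ p * Ly ^ q)) := by gcongr
        _ = _ := by ring)
    have hI : J ⊔ Submodule.span K {f i} = Submodule.span K (f '' Set.Iio (i + 1)) := by
      have : Set.Iio (i + 1) = insert i (Set.Iio i) := by
        ext j
        simp only [Set.mem_Iio, Set.mem_insert_iff]
        omega
      rw [this, Set.image_insert_eq, Submodule.span_insert, sup_comm]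
    rw [← Submodule.sup_mul, hI] at h3
    omega

theorem finite_setOf_finrank_span_mul_lt {S : Submodule K P} (hS : S.FG) (f g : ℕ → P) (i : ℕ) :
    {s : K | finrank K ↥(Submodule.span K ((fun j => g j + s • f j) '' Set.Iio i) * S) <
      finrank K ↥(Submodule.span K (f '' Set.Iio i) * S)}.Finite := by
  have := (Submodule.fg_iff_finiteDimensional _).1 hS
  let φ : (ℕ → P) → (Fin i → S) →ₗ[K] P := fun h =>
    ∑ j : Fin i, LinearMap.mulLeft K (h j) ∘ₗ S.subtype ∘ₗ LinearMap.proj j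
  have hφ : ∀ h x, φ h x = ∑ j : Fin i, h j * x j := fun h x => by simp [φ]
  have hrange : ∀ h, LinearMap.range (φ h) = Submodule.span K (h '' Set.Iio i) * S := by
    intro h
    apply le_antisymm
    · rintro _ ⟨x, rfl⟩
      rw [hφ]
      exact Submodule.sum_mem _ fun j _ => Submodule.mul_mem_mul
        (Submodule.subset_span ⟨j, j.2, rfl⟩) (x j).2
    · conv_lhs => rw [← S.span_eq]
      rw [Submodule.span_mul_span, Submodule.span_le]
      rintro _ ⟨_, ⟨j, hj, rfl⟩, y, hy, rfl⟩
      refine ⟨Pi.single ⟨j, hj⟩ ⟨y, hy⟩, ?_⟩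
      rw [hφ, Finset.sum_eq_single ⟨j, hj⟩]
      · simp
      · intro b _ hb
        simp [Pi.single_eq_of_ne hb]
      · simp
  have hadd : ∀ s : K, φ (fun j => g j + s • f j) = φ g + s • φ f := by
    intro s
    ext x
    simp only [LinearMap.add_apply, LinearMap.smul_apply, LinearMap.coe_comp, Function.comp_apply,
      hφ, Finset.smul_sum, ← Finset.sum_add_distrib, add_mul, smul_mul_assoc]
  refine (finite_setOf_finrank_range_add_smul_lt (φ f) (φ g)).subset fun s hs => ?_
  have hs := Set.mem_ofPred.1 hs
  refine Set.mem_ofPred.2 ?_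
  rwa [← hadd, hrange f, hrange fun j => g j + s • f j]

end Generic

/-- If the quotients `T e / I e` have the same odd dimension and multiplication by `z` is onto from
each to the next, then some real point `χ` of the multiplication algebra annihilates the ideal. -/
theorem exists_character_of_odd {P : Type*} [CommRing P] [Algebra ℝ P] {R : Submodule ℝ P}
    {T I : ℕ → Submodule ℝ P} (hRT : ∀ e, R * T e ≤ T (e + 1)) (hRI : ∀ e, R * I e ≤ I (e + 1))
    (hIT : ∀ e, I e ≤ T e) (hfin : ∀ e, (T e).FG) {c : ℕ} (hc : Odd c)
    (hdim : ∀ e, finrank ℝ (T e) = finrank ℝ (I e) + c) (z : R)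
    (hz : ∀ e, T (e + 1) ≤ I (e + 1) ⊔ Submodule.span ℝ {(z : P)} * T e) :
    ∃ χ : R →ₗ[ℝ] ℝ, χ z = 1 ∧
      (∀ w : R, Submodule.span ℝ {(w : P)} * T 0 ≤ I 1 → χ w = 0) ∧
      ∀ a b c d : R, (a * b : P) = c * d → χ a * χ b = χ c * χ d := by
  have hfd := fun e => (Submodule.fg_iff_finiteDimensional _).1 (hfin e)
  let J : ∀ e, Submodule ℝ (T e) := fun e => (I e).comap (T e).subtype
  let M : ∀ e, R → T e →ₗ[ℝ] T (e + 1) := fun e w =>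
    (LinearMap.mulLeft ℝ (w : P)).restrict fun x hx => hRT e (Submodule.mul_mem_mul w.2 hx)
  have hM : ∀ e w x, (M e w x : P) = w * x := fun e w x => rfl
  have hMJ : ∀ e w, J e ≤ (J (e + 1)).comap (M e w) := fun e w x hx =>
    hRI e (Submodule.mul_mem_mul w.2 hx)
  let W : ∀ e, R → (T e ⧸ J e) →ₗ[ℝ] T (e + 1) ⧸ J (e + 1) := fun e w =>
    (J e).mapQ (J (e + 1)) (M e w) (hMJ e w)
  have hW : ∀ e w x, W e w (Submodule.Quotient.mk x) = Submodule.Quotient.mk (M e w x) :=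
    fun e w x => rfl
  have hQ : ∀ e, finrank ℝ (T e ⧸ J e) = c := by
    intro e
    have h1 := (J e).finrank_quotient_add_finrank
    have h2 : finrank ℝ (J e) = finrank ℝ (I e) :=
      (Submodule.comapSubtypeEquivOfLe (hIT e)).finrank_eq
    have h3 := hdim e
    omega
  have hsurj : ∀ e, Function.Surjective (W e z) := by
    intro e y
    obtain ⟨y, rfl⟩ := Submodule.Quotient.mk_surjective _ y
    obtain ⟨u, hu, v, hv, huv⟩ := Submodule.mem_sup.1 (hz e y.2)
    obtain ⟨x, hx, rfl⟩ := Submodule.mem_span_singleton_mul.1 hv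
    refine ⟨Submodule.Quotient.mk ⟨x, hx⟩, ?_⟩
    rw [hW, Submodule.Quotient.eq]
    change (z * x - y : P) ∈ I (e + 1)
    rw [← huv]
    simpa using hu
  have hinj : ∀ e, Function.Injective (W e z) := fun e =>
    (LinearMap.injective_iff_surjective_of_finrank_eq_finrank
      ((hQ e).trans (hQ (e + 1)).symm)).2 (hsurj e)
  have hcomm : ∀ v w x, W 1 v (W 0 w x) = W 1 w (W 0 v x) := by
    intro v w x
    obtain ⟨x, rfl⟩ := Submodule.Quotient.mk_surjective _ x
    rw [hW, hW, hW, hW]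
    congr 1
    ext
    simp only [hM]
    ring
  obtain ⟨v, hv, χ, hχ⟩ := exists_common_relative_eigenvector (by rw [hQ]; exact hc)
    (LinearEquiv.ofBijective (W 0 z) ⟨hinj 0, hsurj 0⟩) (W 1 z) (hinj 1) (W 0) (W 1) hcomm
    (fun i x => hcomm i z x)
  have hχ' : ∀ w, W 0 w v = χ w • W 0 z v := hχ
  have hzv : W 0 z v ≠ 0 := fun h => hv (hinj 0 (by rw [h, map_zero]))
  have hadd : ∀ a b, W 0 (a + b) v = W 0 a v + W 0 b v := by
    intro a b
    obtain ⟨x, rfl⟩ := Submodule.Quotient.mk_surjective _ v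
    rw [hW, hW, hW, ← Submodule.Quotient.mk_add]
    congr 1
    ext
    simp [hM, add_mul]
  have hsmul : ∀ (r : ℝ) a, W 0 (r • a) v = r • W 0 a v := by
    intro r a
    obtain ⟨x, rfl⟩ := Submodule.Quotient.mk_surjective _ v
    rw [hW, hW, ← Submodule.Quotient.mk_smul]
    congr 1
    ext
    simp [hM]
  have hcancel := smul_left_injective ℝ hzv
  refine ⟨⟨⟨χ, fun a b => hcancel ?_⟩, fun r a => hcancel ?_⟩, hcancel ?_, fun w hw => hcancel ?_,
    fun a b c d h => ?_⟩
  · simp only [add_smul, ← hχ', hadd]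
  · simp only [smul_assoc, ← hχ', hsmul, RingHom.id_apply]
  · simp [← hχ']
  · simp only [LinearMap.coe_mk, AddHom.coe_mk, zero_smul, ← hχ']
    obtain ⟨x, rfl⟩ := Submodule.Quotient.mk_surjective _ v
    rw [hW, Submodule.Quotient.mk_eq_zero]
    exact hw (Submodule.mul_mem_mul (Submodule.mem_span_singleton_self _) x.2)
  · have key : ∀ a b, W 1 a (W 0 b v) = (χ a * χ b) • W 1 z (W 0 z v) := by
      intro a b
      rw [hχ' b, map_smul, hcomm a z, hχ' a, map_smul, smul_smul, mul_comm]
    have hne : W 1 z (W 0 z v) ≠ 0 := fun h => hzv (hinj 1 (by rw [h, map_zero]))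
    refine smul_left_injective ℝ hne ?_
    change (χ a * χ b) • _ = (χ c * χ d) • _
    rw [← key, ← key]
    obtain ⟨x, rfl⟩ := Submodule.Quotient.mk_surjective _ v
    rw [hW, hW, hW, hW]
    congr 1
    ext
    simp only [hM, ← mul_assoc, h]

section LinearForms

open MvPolynomial

/-- The linear form with given coefficients in the variables `X (e a)`. -/
def linForm {σ : Type*} {n : ℕ} (e : Fin n → σ) : (Fin n → ℝ) →ₗ[ℝ] MvPolynomial σ ℝ :=
  Fintype.linearCombination ℝ fun a => X (e a)

theorem X_mem_range_linForm {σ : Type*} {n : ℕ} (e : Fin n → σ) (a : Fin n) :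
    (X (e a) : MvPolynomial σ ℝ) ∈ LinearMap.range (linForm e) := by
  classical
  refine ⟨Pi.single a 1, ?_⟩
  simp [linForm, Fintype.linearCombination_apply_single]

theorem fg_range_linForm {σ : Type*} {n : ℕ} (e : Fin n → σ) : (LinearMap.range (linForm e)).FG :=
  (Submodule.fg_iff_finiteDimensional _).2 inferInstance

/-- The linear forms on the moment curve. -/
def momentForm {σ : Type*} {n : ℕ} (e : Fin n → σ) (j : ℕ) : MvPolynomial σ ℝ :=
  linForm e fun a => (j : ℝ) ^ (a : ℕ)

theorem range_linForm_le_span_momentForm {σ : Type*} {n : ℕ} (e : Fin n → σ) (A : Finset ℕ)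
    (hA : n ≤ A.card) :
    LinearMap.range (linForm e) ≤ Submodule.span ℝ (momentForm e '' A) := by
  let v : Fin n → ℕ := fun i => A.orderEmbOfCardLe hA i
  have hv : Function.Injective fun i => (v i : ℝ) :=
    Nat.cast_injective.comp (A.orderEmbOfCardLe hA).injective
  have hdet := Matrix.det_vandermonde_ne_zero_iff.2 hv
  have hspan := (Matrix.linearIndependent_rows_of_det_ne_zero hdet).span_eq_top_of_card_eq_finrank'
    (by simp)
  rw [LinearMap.range_eq_map, ← hspan, Submodule.map_span, Submodule.span_le]
  rintro _ ⟨_, ⟨i, rfl⟩, rfl⟩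
  exact Submodule.subset_span ⟨v i, A.orderEmbOfCardLe_mem hA i, rfl⟩

theorem prod_X_mem_pow {σ : Type*} {n : ℕ} (e : Fin n → σ) (s : Multiset (Fin n)) :
    (s.map fun a => (X (e a) : MvPolynomial σ ℝ)).prod ∈
      LinearMap.range (linForm e) ^ Multiset.card s := by
  induction s using Multiset.induction_on with
  | empty => simp [Submodule.one_le.1 le_rfl]
  | cons a s ih =>
    rw [Multiset.map_cons, Multiset.prod_cons, Multiset.card_cons, pow_succ']
    exact Submodule.mul_mem_mul (X_mem_range_linForm e a) ih

theorem prod_X_eq_monomial {σ : Type*} [DecidableEq σ] (s : Multiset σ) :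
    (s.map fun a => (X a : MvPolynomial σ ℝ)).prod = monomial (Multiset.toFinsupp s) 1 := by
  induction s using Multiset.induction_on with
  | empty => simp
  | cons a s ih =>
    rw [Multiset.map_cons, Multiset.prod_cons, ih, ← Multiset.singleton_add, map_add,
      Multiset.toFinsupp_singleton, X, monomial_mul, one_mul]

theorem multichoose_mul_multichoose_le_finrank (n m p q : ℕ) :
    n.multichoose p * m.multichoose q ≤
      finrank ℝ ↥(LinearMap.range (linForm (Sum.inl : Fin n → Fin n ⊕ Fin m)) ^ p *
        LinearMap.range (linForm (Sum.inr : Fin m → Fin n ⊕ Fin m)) ^ q) := by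
  classical
  set S := LinearMap.range (linForm (Sum.inl : Fin n → Fin n ⊕ Fin m)) ^ p *
        LinearMap.range (linForm (Sum.inr : Fin m → Fin n ⊕ Fin m)) ^ q
  have := (Submodule.fg_iff_finiteDimensional S).1
    (((fg_range_linForm _).pow p).mul ((fg_range_linForm _).pow q))
  let d : Sym (Fin n) p × Sym (Fin m) q → Fin n ⊕ Fin m →₀ ℕ := fun x =>
    Multiset.toFinsupp ((x.1 : Multiset (Fin n)).map Sum.inl + (x.2 : Multiset (Fin m)).map Sum.inr)
  have hd : Function.Injective d := by
    intro x y hxy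
    have h := Multiset.toFinsupp.injective hxy
    have hnone : ∀ {α β : Type} (s : Multiset α), s.filterMap (fun _ => (none : Option β)) = 0 := by
      intro α β s
      induction s using Multiset.induction_on with
      | empty => rfl
      | cons a s ih => rw [Multiset.filterMap_cons_none _ _ rfl, ih]
    have h1 := congrArg (Multiset.filterMap Sum.getLeft?) h
    have h2 := congrArg (Multiset.filterMap Sum.getRight?) h
    simp only [Multiset.filterMap_add, Multiset.filterMap_map] at h1 h2
    ext1
    · apply Sym.coe_injective
      simpa [Function.comp_def, hnone] using h1
    · apply Sym.coe_injective
      simpa [Function.comp_def, hnone] using h2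
  have hmem : ∀ x, (monomial (d x) 1 : MvPolynomial (Fin n ⊕ Fin m) ℝ) ∈ S := by
    intro x
    rw [← prod_X_eq_monomial, Multiset.map_add, Multiset.prod_add, Multiset.map_map,
      Multiset.map_map]
    have h1 := prod_X_mem_pow (Sum.inl : Fin n → Fin n ⊕ Fin m) x.1
    have h2 := prod_X_mem_pow (Sum.inr : Fin m → Fin n ⊕ Fin m) x.2
    rw [Sym.card_coe] at h1 h2
    exact Submodule.mul_mem_mul h1 h2
  have hli : LinearIndependent ℝ fun x => (⟨monomial (d x) 1, hmem x⟩ : S) := by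
    apply LinearIndependent.of_comp S.subtype
    have := (basisMonomials (Fin n ⊕ Fin m) ℝ).linearIndependent.comp d hd
    simpa [Function.comp_def] using this
  have := hli.fintype_card_le_finrank
  rwa [Fintype.card_prod, Sym.card_sym_eq_multichoose, Sym.card_sym_eq_multichoose,
    Fintype.card_fin, Fintype.card_fin] at this

end LinearForms

/-- Real zeros exist for all but countably many members of the pencil joining `n + m` bilinear forms
to the products of linear forms on the moment curve. -/
theorem exists_countable_forall_exists_zero {n m : ℕ} (hodd : Odd ((n + m).choose n))
    (g : ℕ → Fin (n + 1) → Fin (m + 1) → ℝ) :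
    ∃ E : Set ℝ, E.Countable ∧ ∀ s ∉ E, ∃ x : Fin (n + 1) → ℝ, x ≠ 0 ∧ ∃ y : Fin (m + 1) → ℝ,
      y ≠ 0 ∧ ∀ i < n + m,
        ∑ a, ∑ b, (g i a b + s * ((i : ℝ) ^ (a : ℕ) * (i : ℝ) ^ (b : ℕ))) * (x a * y b) = 0 := by
  set σ := Fin (n + 1) ⊕ Fin (m + 1)
  set ex : Fin (n + 1) → σ := Sum.inl
  set ey : Fin (m + 1) → σ := Sum.inr
  set Lx := LinearMap.range (linForm ex) with hLx
  set Ly := LinearMap.range (linForm ey) with hLy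
  set k := n + m with hk
  have hLxfg : Lx.FG := fg_range_linForm ex
  have hLyfg : Ly.FG := fg_range_linForm ey
  have hl : ∀ j, momentForm ex j ∈ Lx := fun j => LinearMap.mem_range_self _ _
  have hm : ∀ j, momentForm ey j ∈ Ly := fun j => LinearMap.mem_range_self _ _
  let XY : Fin (n + 1) → Fin (m + 1) → ↥(Lx * Ly) := fun a b =>
    ⟨MvPolynomial.X (ex a) * MvPolynomial.X (ey b),
      Submodule.mul_mem_mul (X_mem_range_linForm ex a) (X_mem_range_linForm ey b)⟩
  let f₀ : ℕ → MvPolynomial σ ℝ := fun j => momentForm ex j * momentForm ey j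
  let F : (Fin (n + 1) → Fin (m + 1) → ℝ) → ↥(Lx * Ly) := fun c => ∑ a, ∑ b, c a b • XY a b
  let G : ℕ → MvPolynomial σ ℝ := fun j => if j < k then (F (g j) : MvPolynomial σ ℝ) else 0
  let E : Set ℝ := ⋃ (i : ℕ) (p : ℕ) (q : ℕ),
    {s : ℝ | finrank ℝ ↥(Submodule.span ℝ ((fun j => G j + s • f₀ j) '' Set.Iio i) *
        (Lx ^ p * Ly ^ q)) <
      finrank ℝ ↥(Submodule.span ℝ (f₀ '' Set.Iio i) * (Lx ^ p * Ly ^ q))}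
  refine ⟨E, Set.countable_iUnion fun i => Set.countable_iUnion fun p => Set.countable_iUnion
    fun q => (finite_setOf_finrank_span_mul_lt ((hLxfg.pow p).mul (hLyfg.pow q)) f₀ G i).countable,
    fun s hs => ?_⟩
  simp only [E, Set.mem_iUnion, not_exists] at hs
  let cf : ℕ → Fin (n + 1) → Fin (m + 1) → ℝ := fun j a b =>
    (if j < k then g j a b else 0) + s * ((j : ℝ) ^ (a : ℕ) * (j : ℝ) ^ (b : ℕ))
  let f : ℕ → ↥(Lx * Ly) := fun j => F (cf j)
  have hf₀ : ∀ j, f₀ j = F fun a b => (j : ℝ) ^ (a : ℕ) * (j : ℝ) ^ (b : ℕ) := by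
    intro j
    simp only [f₀, momentForm, linForm, Fintype.linearCombination_apply, Finset.sum_mul_sum, F, XY,
      Submodule.coe_sum, Submodule.coe_smul, smul_mul_smul_comm]
  have hfG : ∀ j, G j + s • f₀ j = f j := by
    intro j
    rw [hf₀]
    by_cases hj : j < k
    · simp [G, f, cf, F, hj, add_smul, Finset.sum_add_distrib, Finset.smul_sum, mul_smul]
    · simp [G, f, cf, F, hj, Finset.smul_sum, mul_smul]
  have hle : ∀ i p q, finrank ℝ ↥(Submodule.span ℝ (f₀ '' Set.Iio i) * (Lx ^ p * Ly ^ q)) ≤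
      finrank ℝ ↥(Submodule.span ℝ ((fun j => (f j : MvPolynomial σ ℝ)) '' Set.Iio i) *
        (Lx ^ p * Ly ^ q)) := by
    intro i p q
    rw [← funext hfG]
    exact not_lt.1 fun h => hs i p q (Set.mem_ofPred.2 h)
  have hdimf := finrank_eq_finrank_add_genericHilbert hLxfg hLyfg
    (f := fun j => (f j : MvPolynomial σ ℝ)) hl hm
    (range_linForm_le_span_momentForm ex) (range_linForm_le_span_momentForm ey)
    (multichoose_mul_multichoose_le_finrank (n + 1) (m + 1)) (fun j => (f j).2)
    hle
  set fv : ℕ → MvPolynomial σ ℝ := fun j => (f j : MvPolynomial σ ℝ)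
  set Jk := Submodule.span ℝ (fv '' Set.Iio k) with hJk
  have hJkle : Jk ≤ Lx * Ly := by
    rw [hJk, Submodule.span_le]
    rintro _ ⟨j, -, rfl⟩
    exact (f j).2
  obtain ⟨χ, hχ1, hχ0, hχ⟩ := exists_character_of_odd (R := Lx * Ly)
    (T := fun e => Lx ^ (e + k + 2) * Ly ^ (e + k + 2))
    (I := fun e => Jk * (Lx ^ (e + k + 1) * Ly ^ (e + k + 1)))
    (fun e => le_of_eq (by ring)) (fun e => le_of_eq (by ring))
    (fun e => calc
      Jk * (Lx ^ (e + k + 1) * Ly ^ (e + k + 1)) ≤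
        (Lx * Ly) * (Lx ^ (e + k + 1) * Ly ^ (e + k + 1)) := by gcongr
      _ = _ := by ring)
    (fun e => (hLxfg.pow _).mul (hLyfg.pow _)) hodd
    (fun e => by
      have h := hdimf k (e + k + 1) (e + k + 1) (by omega) (by omega)
      rwa [genericHilbert_eq_choose k n m _ _ hk (by omega) (by omega)] at h)
    (f k)
    (fun e => by
      have h := hdimf (k + 1) (e + k + 2) (e + k + 2) (by omega) (by omega)
      rw [genericHilbert_eq_zero _ _ _ _ _ (by omega) (by omega) (by omega), add_zero] at h
      have hI : Set.Iio (k + 1) = insert k (Set.Iio k) := by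
        ext j
        simp only [Set.mem_Iio, Set.mem_insert_iff]
        omega
      rw [hI, Set.image_insert_eq, Submodule.span_insert, sup_comm, Submodule.sup_mul] at h
      have hfk : Submodule.span ℝ {fv k} ≤ Lx * Ly := by simp [fv]
      have := (Submodule.fg_iff_finiteDimensional _).1
        ((hLxfg.pow (e + k + 2 + 1)).mul (hLyfg.pow (e + k + 2 + 1)))
      have h' := Submodule.eq_of_le_of_finrank_le (sup_le
        (calc Jk * (Lx ^ (e + k + 2) * Ly ^ (e + k + 2)) ≤
              (Lx * Ly) * (Lx ^ (e + k + 2) * Ly ^ (e + k + 2)) := by gcongr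
          _ = Lx ^ (e + k + 2 + 1) * Ly ^ (e + k + 2 + 1) := by ring)
        (calc Submodule.span ℝ {fv k} * (Lx ^ (e + k + 2) * Ly ^ (e + k + 2)) ≤
              (Lx * Ly) * (Lx ^ (e + k + 2) * Ly ^ (e + k + 2)) := by gcongr
          _ = Lx ^ (e + k + 2 + 1) * Ly ^ (e + k + 2 + 1) := by ring)) h.le
      have e1 : e + 1 + k + 2 = e + k + 2 + 1 := by omega
      have e2 : e + 1 + k + 1 = e + k + 2 := by omega
      rw [e1, e2]
      exact h'.ge)
  have hχF : ∀ c, χ (F c) = ∑ a, ∑ b, c a b * χ (XY a b) := fun c => by simp [F]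
  obtain ⟨a₀, b₀, hab⟩ : ∃ a b, χ (XY a b) ≠ 0 := by
    by_contra! h
    have : χ (f k) = 0 := by
      rw [hχF]
      simp [h]
    rw [this] at hχ1
    exact zero_ne_one hχ1
  refine ⟨fun a => χ (XY a b₀), fun h => hab (congrFun h a₀), fun b => χ (XY a₀ b),
    fun h => hab (congrFun h b₀), fun i hi => ?_⟩
  have h0 : χ (f i) = 0 := by
    apply hχ0
    have e1 : 0 + k + 2 = 1 + k + 1 := by omega
    rw [e1]
    refine mul_le_mul_left (Submodule.span_mono ?_) _
    exact Set.singleton_subset_iff.2 ⟨i, hi, rfl⟩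
  rw [hχF] at h0
  have hprod : ∀ a b, χ (XY a b₀) * χ (XY a₀ b) = χ (XY a b) * χ (XY a₀ b₀) := fun a b =>
    hχ _ _ _ _ (by simp only [XY]; ring)
  simp only [hprod, ← mul_assoc, ← Finset.sum_mul]
  simp only [cf, if_pos hi, ← mul_assoc] at h0
  rw [h0, zero_mul]

/-- If `(n + m).choose n` is odd, then any `n + m` real bilinear forms in `n + 1` and `m + 1`
variables have a common nontrivial zero. -/
theorem exists_common_zero_of_odd_choose {n m : ℕ} (hodd : Odd ((n + m).choose n))
    (g : ℕ → Fin (n + 1) → Fin (m + 1) → ℝ) :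
    ∃ x : Fin (n + 1) → ℝ, x ≠ 0 ∧ ∃ y : Fin (m + 1) → ℝ, y ≠ 0 ∧
      ∀ i < n + m, ∑ a, ∑ b, g i a b * (x a * y b) = 0 := by
  obtain ⟨E, hE, hzero⟩ := exists_countable_forall_exists_zero hodd g
  let Sx := Metric.sphere (0 : Fin (n + 1) → ℝ) 1
  let Sy := Metric.sphere (0 : Fin (m + 1) → ℝ) 1
  let C : Set (ℝ × (Sx × Sy)) := {t | ∀ i < n + m,
    ∑ a, ∑ b, (g i a b + t.1 * ((i : ℝ) ^ (a : ℕ) * (i : ℝ) ^ (b : ℕ))) *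
      (t.2.1.1 a * t.2.2.1 b) = 0}
  have hC : IsClosed C := by
    have hx : ∀ a, Continuous fun t : ℝ × (Sx × Sy) => t.2.1.1 a := fun a =>
      (continuous_apply a).comp (continuous_subtype_val.comp (continuous_fst.comp continuous_snd))
    have hy : ∀ b, Continuous fun t : ℝ × (Sx × Sy) => t.2.2.1 b := fun b =>
      (continuous_apply b).comp (continuous_subtype_val.comp (continuous_snd.comp continuous_snd))
    simp only [C, Set.ofPred_forall]
    refine isClosed_iInter fun i => isClosed_iInter fun _ => isClosed_eq ?_ continuous_const
    fun_prop
  have hclosed : IsClosed (Prod.fst '' C) := isClosedMap_fst_of_compactSpace C hC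
  have hsub : Eᶜ ⊆ Prod.fst '' C := by
    intro s hs
    obtain ⟨x, hx, y, hy, h⟩ := hzero s hs
    refine ⟨(s, ⟨‖x‖⁻¹ • x, ?_⟩, ⟨‖y‖⁻¹ • y, ?_⟩), fun i hi => ?_, rfl⟩
    · simp [Sx, norm_smul, hx]
    · simp [Sy, norm_smul, hy]
    · have := congrArg (fun r => (‖x‖⁻¹ * ‖y‖⁻¹) * r) (h i hi)
      simp only [mul_zero, Finset.mul_sum] at this
      refine Eq.trans ?_ this
      refine Finset.sum_congr rfl fun a _ => Finset.sum_congr rfl fun b _ => ?_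
      simp only [Pi.smul_apply, smul_eq_mul]
      ring
  have h0 : (0 : ℝ) ∈ Prod.fst '' C :=
    hclosed.closure_subset_iff.2 hsub ((hE.dense_compl ℝ) 0)
  obtain ⟨⟨s, x, y⟩, hxy, rfl⟩ := h0
  refine ⟨x, fun h => ?_, y, fun h => ?_, fun i hi => ?_⟩
  · simpa [Sx, h] using x.2
  · simpa [Sy, h] using y.2
  · simpa using hxy i hi

theorem exists_apply_eq_zero_of_odd_choose {m d k n l : ℕ} (hkn : k = n + l) (hnm : n < m)
    (hld : l < d) (hodd : Odd (k.choose n)) (f : (Fin m → ℝ) →ₗ[ℝ] (Fin d → ℝ) →ₗ[ℝ] Fin k → ℝ) :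
    ∃ x ≠ 0, ∃ y ≠ 0, f x y = 0 := by
  subst hkn
  let φ : (Fin (n + 1) → ℝ) →ₗ[ℝ] Fin m → ℝ :=
    Fintype.linearCombination ℝ fun a => Pi.single (Fin.castLE hnm a) 1
  let ψ : (Fin (l + 1) → ℝ) →ₗ[ℝ] Fin d → ℝ :=
    Fintype.linearCombination ℝ fun b => Pi.single (Fin.castLE hld b) 1
  have hφ : ∀ x, x ≠ 0 → φ x ≠ 0 := fun x hx h => hx <| by
    ext a
    simpa [φ, Fintype.linearCombination_apply, Pi.single_apply] using
      congrFun h (Fin.castLE hnm a)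
  have hψ : ∀ y, y ≠ 0 → ψ y ≠ 0 := fun y hy h => hy <| by
    ext b
    simpa [ψ, Fintype.linearCombination_apply, Pi.single_apply] using
      congrFun h (Fin.castLE hld b)
  obtain ⟨x, hx, y, hy, h⟩ := exists_common_zero_of_odd_choose hodd fun i a b =>
    if hi : i < n + l then
      f (Pi.single (Fin.castLE hnm a) 1) (Pi.single (Fin.castLE hld b) 1) ⟨i, hi⟩
    else 0
  refine ⟨φ x, hφ x hx, ψ y, hψ y hy, funext fun i => ?_⟩
  rw [Pi.zero_apply, ← h i i.2]
  simp only [φ, ψ, Fintype.linearCombination_apply, map_sum, map_smul, LinearMap.sum_apply,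
    LinearMap.smul_apply, Finset.sum_apply, Pi.smul_apply, smul_eq_mul, Finset.mul_sum,
    dif_pos i.2, Fin.eta]
  rw [Finset.sum_comm]
  refine Finset.sum_congr rfl fun a _ => Finset.sum_congr rfl fun b _ => ?_
  ring

end NonsingularBilinear

/-- If there exists a nonsingular bilinear map `ℝ^m × ℝ^d → ℝ^k`, then for every `j`
with `k − d < j < m` and `0 ≤ j ≤ k`, the binomial coefficient `C(k, j)` is even. -/
theorem statement_6 (m d k : ℕ) (hm : 1 ≤ m) (hd : 1 ≤ d) (hk : 1 ≤ k)
    (f : (Fin m → ℝ) → (Fin d → ℝ) → (Fin k → ℝ))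
    (hbil : IsBilin ℝ f) (hns : Nonsingular f) :
    ∀ j : ℕ, (k : ℤ) - (d : ℤ) < (j : ℤ) → j < m → j ≤ k → 2 ∣ Nat.choose k j := by
  obtain ⟨hadd₁, hsmul₁, hadd₂, hsmul₂⟩ := hbil
  intro j hdj hjm hjk
  by_contra hj
  obtain ⟨x, hx, y, hy, h⟩ := exists_apply_eq_zero_of_odd_choose (l := k - j) (by omega) hjm
    (by omega) (Nat.not_even_iff_odd.1 fun h => hj h.two_dvd)
    (LinearMap.mk₂ ℝ f hadd₁ hsmul₁ hadd₂ hsmul₂)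
  exact (hns x y h).elim hx hy
end
end

section
/- Let d, k ≥ 1. If there exists a nonsingular bilinear map f : ℝ^d × ℝ^d → ℝ^k, then k ≥ 2^⌈log₂(d)⌉. -/
noncomputable section

section

open Filter Topology Module

/-- A monic real polynomial of odd degree has a root. -/
theorem exists_isRoot_of_monic_of_odd {p : Polynomial ℝ} (hp : p.Monic) (h : Odd p.natDegree) :
    ∃ c, p.IsRoot c := by
  have hdeg : 0 < p.degree := Polynomial.natDegree_pos_iff_degree_pos.1 h.pos
  have h1 := p.tendsto_atTop_of_leadingCoeff_nonneg hdeg (by simp [hp.leadingCoeff])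
  have hX : (-Polynomial.X : Polynomial ℝ).natDegree = 1 := by simp
  have h2 := (p.comp (-Polynomial.X)).tendsto_atBot_of_leadingCoeff_nonpos
    (Polynomial.natDegree_pos_iff_degree_pos.1 (by
      rw [Polynomial.natDegree_comp, hX, mul_one]; exact h.pos))
    (by rw [Polynomial.leadingCoeff_comp (by simp)]; simp [hp.leadingCoeff, h.neg_one_pow])
  obtain ⟨a, ha⟩ := (h1.eventually_ge_atTop 0).exists
  obtain ⟨b, hb⟩ := (h2.eventually_le_atBot 0).exists
  obtain ⟨c, hc⟩ := mem_range_of_exists_le_of_exists_ge p.continuous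
    ⟨-b, by simpa [Polynomial.eval_comp] using hb⟩ ⟨a, ha⟩
  exact ⟨c, hc⟩

/-- An endomorphism of an odd-dimensional real vector space has an eigenvalue. -/
theorem exists_hasEigenvalue_of_odd {V : Type*} [AddCommGroup V] [Module ℝ V]
    [FiniteDimensional ℝ V] (hV : Odd (finrank ℝ V)) (A : End ℝ V) :
    ∃ c, A.HasEigenvalue c := by
  have h : Odd A.charpoly.natDegree := by rwa [LinearMap.charpoly_natDegree]
  obtain ⟨c, hc⟩ := exists_isRoot_of_monic_of_odd A.charpoly_monic h
  exact ⟨c, (Module.End.hasEigenvalue_iff_isRoot_charpoly A c).2 hc⟩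

/-- A commuting family of endomorphisms of an odd-dimensional real vector space has a common
eigenvector. -/
theorem exists_common_eigenvector_of_odd {ι : Type*} (n : ℕ) :
    ∀ {V : Type*} [AddCommGroup V] [Module ℝ V] [FiniteDimensional ℝ V],
      finrank ℝ V = n → Odd n → ∀ A : ι → End ℝ V, (∀ i j, Commute (A i) (A j)) →
      ∃ (v : V) (c : ι → ℝ), v ≠ 0 ∧ ∀ i, A i v = c i • v := by
  induction n using Nat.strong_induction_on with
  | _ n ih =>
  intro V _ _ _ hn hodd A hA
  by_cases hs : ∀ i, ∃ c : ℝ, A i = c • LinearMap.id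
  · choose c hc using hs
    have : Nontrivial V := Module.nontrivial_of_finrank_pos (R := ℝ) (hn ▸ hodd.pos)
    obtain ⟨v, hv⟩ := exists_ne (0 : V)
    exact ⟨v, c, hv, fun i => by simp [hc i]⟩
  · push Not at hs
    obtain ⟨i, hi⟩ := hs
    obtain ⟨c, hc⟩ := exists_hasEigenvalue_of_odd (hn ▸ hodd) (A i)
    set B : End ℝ V := A i - c • 1 with hB
    have hcomm : ∀ j, Commute (A j) B := fun j =>
      (hA j i).sub_right ((Commute.one_right _).smul_right c)
    have hker : B.ker ≠ ⊥ := by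
      have := hc
      rw [Module.End.hasEigenvalue_iff, Module.End.eigenspace_def] at this
      simpa [hB, Algebra.algebraMap_eq_smul_one] using this
    have hrn := B.finrank_range_add_finrank_ker
    have hker0 : 0 < finrank ℝ B.ker := by
      rw [Nat.pos_iff_ne_zero, Ne, Submodule.finrank_eq_zero]; exact hker
    have hrange0 : 0 < finrank ℝ B.range := by
      rw [Nat.pos_iff_ne_zero, Ne, Submodule.finrank_eq_zero, LinearMap.range_eq_bot]
      intro h0
      exact hi c (by rw [hB, sub_eq_zero] at h0; exact h0)
    have key : ∀ W : Submodule ℝ V, (∀ j, ∀ w ∈ W, A j w ∈ W) → finrank ℝ W < n →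
        Odd (finrank ℝ W) → ∃ (v : V) (c : ι → ℝ), v ≠ 0 ∧ ∀ i, A i v = c i • v := by
      intro W hW hlt hWo
      obtain ⟨v, c, hv, hvc⟩ := ih _ hlt rfl hWo (fun j => (A j).restrict (hW j)) (by
        intro j k
        ext w
        simpa using congrArg (fun f : End ℝ V => f w) (hA j k).eq)
      refine ⟨v, c, by simpa using hv, fun j => ?_⟩
      simpa using congrArg Subtype.val (hvc j)
    have hcv : ∀ j v, A j (B v) = B (A j v) := fun j v =>
      congrArg (fun f : End ℝ V => f v) (hcomm j).eq
    rcases Nat.even_or_odd (finrank ℝ B.ker) with he | ho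
    · refine key B.range ?_ (by omega) ?_
      · rintro j _ ⟨v, rfl⟩
        exact ⟨A j v, (hcv j v).symm⟩
      · rw [hn] at hrn
        rw [← hrn] at hodd
        exact (Nat.odd_add.1 hodd).2 he
    · refine key B.ker ?_ (by omega) ho
      intro j w hw
      rw [LinearMap.mem_ker] at hw ⊢
      rw [← hcv, hw, map_zero]

/-- The rank of a pencil `A + t B` is at least that of `B` for small nonzero `t`. -/
theorem eventually_finrank_range_le {E F : Type*} [AddCommGroup E] [Module ℝ E]
    [FiniteDimensional ℝ E] [AddCommGroup F] [Module ℝ F] (A B : E →ₗ[ℝ] F) :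
    ∀ᶠ t in 𝓝[≠] (0 : ℝ), finrank ℝ B.range ≤ finrank ℝ (A + t • B).range := by
  obtain ⟨C, hC⟩ := B.ker.exists_isCompl
  have hinj : (B.domRestrict C).ker = ⊥ := by
    rw [LinearMap.ker_eq_bot']
    intro x hx
    have : (x : E) ∈ B.ker ⊓ C := ⟨hx, x.2⟩
    rw [hC.inf_eq_bot] at this
    simpa using this
  obtain ⟨π, hπ⟩ := (B.domRestrict C).exists_leftInverse_of_injective hinj
  have hdim : finrank ℝ B.range = finrank ℝ C := by
    have h1 := B.finrank_range_add_finrank_ker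
    have h2 := Submodule.finrank_add_eq_of_isCompl hC
    omega
  set M : End ℝ C := π ∘ₗ A.domRestrict C with hM
  have hfin : {t : ℝ | M.HasEigenvalue (-t)}.Finite :=
    (Module.End.finite_hasEigenvalue M).preimage neg_injective.injOn
  have hev : ∀ᶠ t in 𝓝[≠] (0 : ℝ), ¬ M.HasEigenvalue (-t) :=
    nhdsNE_le_cofinite 0 hfin.eventually_cofinite_notMem
  filter_upwards [hev] with t ht
  rw [hdim]
  have hinj' : Function.Injective ((A + t • B).domRestrict C) := by
    rw [← LinearMap.ker_eq_bot, LinearMap.ker_eq_bot']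
    intro x hx
    by_contra hx0
    refine ht (Module.End.hasEigenvalue_of_hasEigenvector (x := x) ⟨?_, hx0⟩)
    rw [Module.End.mem_eigenspace_iff]
    have h1 : A x + t • B x = 0 := hx
    have h2 : π (B x) = x := LinearMap.congr_fun hπ x
    have h3 : M x = π (A x) := rfl
    rw [h3, eq_neg_of_add_eq_zero_left h1, map_neg, map_smul, h2, neg_smul]
  rw [← LinearMap.finrank_range_of_inj hinj']
  exact Submodule.finrank_mono (by rintro _ ⟨x, rfl⟩; exact ⟨x, rfl⟩)

/-- The rank of a pencil `A + t B`, taken modulo a subspace, is at least that of `B` for small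
nonzero `t`. -/
theorem eventually_finrank_sup_range_le {E F : Type*} [AddCommGroup E] [Module ℝ E]
    [FiniteDimensional ℝ E] [AddCommGroup F] [Module ℝ F] (A B : E →ₗ[ℝ] F) (U : Submodule ℝ F)
    [FiniteDimensional ℝ U] :
    ∀ᶠ t in 𝓝[≠] (0 : ℝ),
      finrank ℝ ↥(U ⊔ B.range) ≤ finrank ℝ ↥(U ⊔ (A + t • B).range) := by
  filter_upwards [eventually_finrank_range_le (A.coprod (0 : U →ₗ[ℝ] F)) (B.coprod U.subtype)]
    with t ht
  have h1 : (B.coprod U.subtype).range = U ⊔ B.range := by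
    rw [LinearMap.range_coprod, Submodule.range_subtype, sup_comm]
  rw [h1] at ht
  refine ht.trans (Submodule.finrank_mono ?_)
  rintro _ ⟨⟨x, u⟩, rfl⟩
  refine Submodule.mem_sup.2 ⟨t • (u : F), U.smul_mem t u.2, (A + t • B) x, ⟨x, rfl⟩, ?_⟩
  simp only [LinearMap.add_apply, LinearMap.coprod_apply, LinearMap.smul_apply,
    LinearMap.zero_apply, Submodule.subtype_apply, smul_add]
  abel

/-- The number of monomials of degree `a` in `p` variables, with `a` an arbitrary integer. -/
def numMonomials (p : ℕ) (a : ℤ) : ℤ :=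
  if a < 0 then 0 else (Nat.multichoose p a.toNat : ℤ)

theorem numMonomials_natCast (p a : ℕ) : numMonomials p a = Nat.multichoose p a := by
  simp [numMonomials]

theorem numMonomials_succ (p : ℕ) (a : ℤ) :
    numMonomials (p + 1) a = numMonomials p a + numMonomials (p + 1) (a - 1) := by
  rcases lt_trichotomy a 0 with h | rfl | h
  · simp [numMonomials, h, show a < 1 by omega]
  · simp [numMonomials]
  · obtain ⟨n, rfl⟩ : ∃ n : ℕ, a = n + 1 := ⟨(a - 1).toNat, by omega⟩
    rw [add_sub_cancel_right, numMonomials_natCast, ← Nat.cast_succ, numMonomials_natCast,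
      numMonomials_natCast, Nat.multichoose_succ_succ]
    push_cast; ring

/-- The expected codimension, in bidegree `(a, b)`, of an ideal generated by `k` forms of
bidegree `(1, 1)` in two sets of `p` and `q` variables. -/
def expectedCodim (p q : ℕ) : ℕ → ℤ → ℤ → ℤ
  | 0, a, b => numMonomials p a * numMonomials q b
  | k + 1, a, b => expectedCodim p q k a b - expectedCodim p q k (a - 1) (b - 1)

theorem expectedCodim_succ_succ (p q k : ℕ) : ∀ a b : ℤ,
    expectedCodim (p + 1) (q + 1) (k + 1) a b =
      expectedCodim p (q + 1) k a b + expectedCodim (p + 1) q k (a - 1) b := by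
  induction k with
  | zero =>
    intro a b
    simp only [expectedCodim]
    rw [numMonomials_succ p a, numMonomials_succ q b]
    ring
  | succ k ih =>
    intro a b
    rw [expectedCodim, ih, ih]
    simp only [expectedCodim]
    ring

theorem expectedCodim_zero_left (q k : ℕ) : ∀ a b : ℤ, k < a → expectedCodim 0 q k a b = 0 := by
  induction k with
  | zero =>
    intro a b h
    obtain ⟨n, rfl⟩ : ∃ n : ℕ, a = n + 1 := ⟨(a - 1).toNat, by omega⟩
    rw [expectedCodim, ← Nat.cast_succ, numMonomials_natCast]
    simp
  | succ k ih =>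
    intro a b h
    push_cast at h
    rw [expectedCodim, ih _ _ (by omega), ih _ _ (by omega), sub_zero]

theorem expectedCodim_zero_right (p k : ℕ) : ∀ a b : ℤ, k < b → expectedCodim p 0 k a b = 0 := by
  induction k with
  | zero =>
    intro a b h
    obtain ⟨n, rfl⟩ : ∃ n : ℕ, b = n + 1 := ⟨(b - 1).toNat, by omega⟩
    rw [expectedCodim, ← Nat.cast_succ, numMonomials_natCast]
    simp
  | succ k ih =>
    intro a b h
    push_cast at h
    rw [expectedCodim, ih _ _ (by omega), ih _ _ (by omega), sub_zero]

theorem expectedCodim_add (k : ℕ) : ∀ (p q : ℕ) (a b : ℤ), p + q = k → k < a → k < b →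
    expectedCodim (p + 1) (q + 1) k a b = (k.choose p : ℤ) := by
  induction k with
  | zero =>
    intro p q a b h ha hb
    obtain ⟨rfl, rfl⟩ : p = 0 ∧ q = 0 := by omega
    lift a to ℕ using by omega
    lift b to ℕ using by omega
    simp [expectedCodim, numMonomials_natCast]
  | succ k ih =>
    intro p q a b h ha hb
    push_cast at ha hb
    rw [expectedCodim_succ_succ]
    rcases p with _ | p
    · obtain rfl : q = k + 1 := by omega
      rw [expectedCodim_zero_left _ _ _ _ (by omega),
        ih 0 k _ _ (by omega) (by omega) (by omega)]
      simp
    · rw [ih p q _ _ (by omega) (by omega) (by omega), Nat.choose_succ_succ]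
      rcases q with _ | q
      · obtain rfl : p = k := by omega
        rw [expectedCodim_zero_right _ _ _ _ (by omega)]
        simp
      · rw [ih (p + 1) q _ _ (by omega) (by omega) (by omega)]
        push_cast; ring

/-- The polynomial ring in two infinite sequences of variables. -/
abbrev BiPoly : Type := MvPolynomial (ℕ ⊕ ℕ) ℝ

/-- The variables of the first sequence. -/
def xVar (i : ℕ) : BiPoly := MvPolynomial.X (Sum.inl i)

/-- The variables of the second sequence. -/
def yVar (j : ℕ) : BiPoly := MvPolynomial.X (Sum.inr j)

/-- The span of the first `k` terms of a sequence of polynomials. -/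
def spanLT (F : ℕ → BiPoly) (k : ℕ) : Submodule ℝ BiPoly := Submodule.span ℝ (F '' Set.Iio k)

/-- The forms of bidegree `(a, b)` in the first `p` variables `x` and the first `q`
variables `y`. -/
def biForms (p q a b : ℕ) : Submodule ℝ BiPoly := spanLT xVar p ^ a * spanLT yVar q ^ b

theorem mem_spanLT (F : ℕ → BiPoly) {n k : ℕ} (h : n < k) : F n ∈ spanLT F k :=
  Submodule.subset_span ⟨n, h, rfl⟩

theorem spanLT_le {F : ℕ → BiPoly} {k : ℕ} {U : Submodule ℝ BiPoly} (h : ∀ n < k, F n ∈ U) :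
    spanLT F k ≤ U := by
  rw [spanLT, Submodule.span_le]
  rintro _ ⟨n, hn, rfl⟩
  exact h n hn

theorem spanLT_zero (F : ℕ → BiPoly) : spanLT F 0 = ⊥ := by
  simp [spanLT]

theorem spanLT_succ (F : ℕ → BiPoly) (k : ℕ) :
    spanLT F (k + 1) = spanLT F k + Submodule.span ℝ {F k} := by
  rw [spanLT, spanLT, Submodule.add_eq_sup, ← Submodule.span_union, Set.union_singleton,
    ← Set.image_insert_eq]
  congr 2
  ext n
  simp

theorem spanLT_mono (F : ℕ → BiPoly) {k l : ℕ} (h : k ≤ l) : spanLT F k ≤ spanLT F l :=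
  spanLT_le fun _ hn => mem_spanLT F (hn.trans_le h)

instance (F : ℕ → BiPoly) (k : ℕ) : FiniteDimensional ℝ (spanLT F k) :=
  FiniteDimensional.span_of_finite ℝ ((Set.finite_Iio k).image F)

instance finiteDimensional_mul (U V : Submodule ℝ BiPoly) [hU : FiniteDimensional ℝ U]
    [hV : FiniteDimensional ℝ V] : FiniteDimensional ℝ ↥(U * V) :=
  Module.Finite.iff_fg.2 ((Module.Finite.iff_fg.1 hU).mul (Module.Finite.iff_fg.1 hV))

instance finiteDimensional_add (U V : Submodule ℝ BiPoly) [FiniteDimensional ℝ U]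
    [FiniteDimensional ℝ V] : FiniteDimensional ℝ ↥(U + V) := by
  rw [Submodule.add_eq_sup]
  infer_instance

instance (p q a b : ℕ) : FiniteDimensional ℝ (biForms p q a b) :=
  Module.Finite.iff_fg.2 <| .mul (.pow (Module.Finite.iff_fg.1 inferInstance) a)
    (.pow (Module.Finite.iff_fg.1 inferInstance) b)

theorem biForms_zero_left (q a b : ℕ) : biForms 0 q (a + 1) b = ⊥ := by
  simp [biForms, spanLT_zero, ← Submodule.zero_eq_bot]

theorem biForms_zero_right (p a b : ℕ) : biForms p 0 a (b + 1) = ⊥ := by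
  simp [biForms, spanLT_zero, ← Submodule.zero_eq_bot]

theorem biForms_degree_zero_left (p q b : ℕ) : biForms p q 0 b = spanLT yVar q ^ b :=
  one_mul _

theorem biForms_succ_left (p q a b : ℕ) :
    biForms p q (a + 1) b = spanLT xVar p * biForms p q a b := by
  simp only [biForms]; ring

theorem biForms_succ_right (p q a b : ℕ) :
    biForms p q a (b + 1) = spanLT yVar q * biForms p q a b := by
  simp only [biForms]; ring

/-- In an idempotent semiring, `(u + v) ^ (n + 1) = u ^ (n + 1) + v (u + v) ^ n`. -/
theorem add_pow_succ_of_idem {R : Type*} [IdemCommSemiring R] (u v : R) (n : ℕ) :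
    (u + v) ^ (n + 1) = u ^ (n + 1) + v * (u + v) ^ n := by
  induction n with
  | zero => simp
  | succ n ih =>
    calc (u + v) ^ (n + 1 + 1) = (u + v) * (u + v) ^ (n + 1) := by ring
      _ = u * (u ^ (n + 1) + v * (u + v) ^ n) + v * (u + v) ^ (n + 1) := by rw [add_mul, ← ih]
      _ = u ^ (n + 2) + v * (u * (u + v) ^ n + (u + v) * (u + v) ^ n) := by ring
      _ = u ^ (n + 2) + v * ((u + (u + v)) * (u + v) ^ n) := by ring
      _ = u ^ (n + 1 + 1) + v * (u + v) ^ (n + 1) := by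
        rw [← add_assoc, add_idem u, pow_succ' (u + v) n]

theorem biForms_succ_var_left (p q a b : ℕ) :
    biForms (p + 1) q (a + 1) b =
      biForms p q (a + 1) b + Submodule.span ℝ {xVar p} * biForms (p + 1) q a b := by
  simp only [biForms, spanLT_succ xVar p]
  rw [add_pow_succ_of_idem]
  ring

theorem biForms_succ_var_right (p q a b : ℕ) :
    biForms p (q + 1) a (b + 1) =
      biForms p q a (b + 1) + Submodule.span ℝ {yVar q} * biForms p (q + 1) a b := by
  simp only [biForms, spanLT_succ yVar q]
  rw [add_pow_succ_of_idem]
  ring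

theorem biForms_mono {p q p' q' : ℕ} (a b : ℕ) (hp : p ≤ p') (hq : q ≤ q') :
    biForms p q a b ≤ biForms p' q' a b :=
  mul_le_mul' (pow_le_pow_left' (spanLT_mono _ hp) _) (pow_le_pow_left' (spanLT_mono _ hq) _)

theorem finrank_span_singleton_mul {u : BiPoly} (hu : u ≠ 0) (V : Submodule ℝ BiPoly) :
    finrank ℝ ↥(Submodule.span ℝ {u} * V) = finrank ℝ V := by
  have : Submodule.span ℝ {u} * V = V.map (LinearMap.mulLeft ℝ u) := by
    ext w
    rw [Submodule.mem_span_singleton_mul]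
    rfl
  rw [this]
  exact (Submodule.equivMapOfInjective (LinearMap.mulLeft ℝ u)
    (mul_right_injective₀ hu) V).finrank_eq.symm

/-- Adding multiples of a variable to polynomials which do not contain it. -/
theorem finrank_add_span_X_mul (s : ℕ ⊕ ℕ) (U V : Submodule ℝ BiPoly) [FiniteDimensional ℝ U]
    [FiniteDimensional ℝ V] (hU : ∀ u ∈ U,
      MvPolynomial.aeval (fun i => if i = s then (0 : BiPoly) else MvPolynomial.X i) u = u) :
    finrank ℝ ↥(U + Submodule.span ℝ {(MvPolynomial.X s : BiPoly)} * V) =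
      finrank ℝ U + finrank ℝ V := by
  set W := Submodule.span ℝ {(MvPolynomial.X s : BiPoly)} * V with hW
  have hWV : finrank ℝ W = finrank ℝ V :=
    finrank_span_singleton_mul (MvPolynomial.X_ne_zero s) V
  have hdisj : U ⊓ W = ⊥ := by
    rw [eq_bot_iff]
    rintro u ⟨hu, hw⟩
    obtain ⟨v, -, rfl⟩ := Submodule.mem_span_singleton_mul.1 hw
    rw [← hU _ hu]
    simp
  have := Submodule.finrank_sup_add_finrank_inf_eq U W
  rw [hdisj, finrank_bot, add_zero, hWV] at this
  exact this

theorem aeval_eq_self_of_mem_biForms (s : ℕ ⊕ ℕ) {p q a b : ℕ} (hx : ∀ i < p, Sum.inl i ≠ s)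
    (hy : ∀ j < q, Sum.inr j ≠ s) : ∀ u ∈ biForms p q a b,
      MvPolynomial.aeval (fun i => if i = s then (0 : BiPoly) else MvPolynomial.X i) u = u := by
  set φ : BiPoly →ₐ[ℝ] BiPoly :=
    MvPolynomial.aeval (fun i => if i = s then (0 : BiPoly) else MvPolynomial.X i) with hφ
  set E := (AlgHom.equalizer φ (AlgHom.id ℝ BiPoly)).toSubmodule with hE
  have hmul : E * E ≤ E := (Subalgebra.isIdempotentElem_toSubmodule _).le
  have hpow : ∀ (n : ℕ) (U : Submodule ℝ BiPoly), U ≤ E → U ^ n ≤ E := by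
    intro n U hU
    induction n with
    | zero =>
      rw [pow_zero, Submodule.one_le]
      exact one_mem (AlgHom.equalizer φ (AlgHom.id ℝ BiPoly))
    | succ n ih => rw [pow_succ]; exact (mul_le_mul' ih hU).trans hmul
  have h : biForms p q a b ≤ E := by
    refine (mul_le_mul' (hpow a _ (spanLT_le fun i hi => ?_))
      (hpow b _ (spanLT_le fun j hj => ?_))).trans hmul
    · change φ (xVar i) = xVar i
      simp [hφ, xVar, hx i hi]
    · change φ (yVar j) = yVar j
      simp [hφ, yVar, hy j hj]
  exact fun u hu => h hu

theorem finrank_biForms_left (p a : ℕ) : ∀ q b : ℕ,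
    finrank ℝ (biForms p q a b) = p.multichoose a * finrank ℝ (biForms 0 q 0 b) := by
  induction p generalizing a with
  | zero =>
    intro q b
    rcases a with _ | a
    · simp
    · rw [biForms_zero_left]; simp
  | succ p ihp =>
    intro q b
    induction a with
    | zero => rw [biForms_degree_zero_left, biForms_degree_zero_left]; simp
    | succ a iha =>
      rw [biForms_succ_var_left, xVar, finrank_add_span_X_mul, ihp, iha,
        Nat.multichoose_succ_succ, add_mul]
      exact aeval_eq_self_of_mem_biForms _ (by simp; omega) (by simp)

theorem finrank_biForms_zero (q b : ℕ) : finrank ℝ (biForms 0 q 0 b) = q.multichoose b := by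
  induction q generalizing b with
  | zero =>
    rcases b with _ | b
    · rw [biForms_degree_zero_left, pow_zero, Nat.multichoose_zero_right, Submodule.one_eq_span]
      exact finrank_span_singleton (one_ne_zero (α := BiPoly))
    · rw [biForms_zero_right]; simp
  | succ q ihq =>
    induction b with
    | zero =>
      rw [biForms_degree_zero_left, pow_zero, Nat.multichoose_zero_right, Submodule.one_eq_span]
      exact finrank_span_singleton (one_ne_zero (α := BiPoly))
    | succ b ihb =>
      rw [biForms_succ_var_right, yVar, finrank_add_span_X_mul, ihq, ihb,
        Nat.multichoose_succ_succ]
      exact aeval_eq_self_of_mem_biForms _ (by simp) (by simp; omega)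

theorem finrank_biForms (p q a b : ℕ) :
    (finrank ℝ (biForms p q a b) : ℤ) = expectedCodim p q 0 a b := by
  rw [finrank_biForms_left, finrank_biForms_zero, expectedCodim, numMonomials_natCast,
    numMonomials_natCast, Nat.cast_mul]

/-- The coefficient of `T ^ (p + q - 2 - n)` in the product of the generic polynomials
`∑ i < p, x i T ^ i` and `∑ j < q, y j T ^ j`. -/
def productCoeff (p q n : ℕ) : BiPoly :=
  ∑ i ∈ Finset.range p, ∑ j ∈ Finset.range q,
    if i + j + n + 2 = p + q then xVar i * yVar j else 0

theorem productCoeff_zero (p q : ℕ) : productCoeff (p + 1) (q + 1) 0 = xVar p * yVar q := by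
  rw [productCoeff, Finset.sum_eq_single p, Finset.sum_eq_single q]
  · rw [if_pos (by omega)]
  · intro j hj hne
    rw [Finset.mem_range] at hj
    rw [if_neg (by omega)]
  · simp
  · intro i hi hne
    rw [Finset.mem_range] at hi
    refine Finset.sum_eq_zero fun j hj => ?_
    rw [Finset.mem_range] at hj
    rw [if_neg (by omega)]
  · simp

theorem productCoeff_succ_left (p q n : ℕ) : productCoeff (p + 1) q (n + 1) =
    productCoeff p q n +
      xVar p * ∑ j ∈ Finset.range q, if j + n + 2 = q then yVar j else 0 := by
  rw [productCoeff, Finset.sum_range_succ, productCoeff, Finset.mul_sum]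
  congr 1
  · refine Finset.sum_congr rfl fun i _ => Finset.sum_congr rfl fun j _ => ?_
    simp only [show i + j + (n + 1) + 2 = p + 1 + q ↔ i + j + n + 2 = p + q by omega]
  · refine Finset.sum_congr rfl fun j _ => ?_
    simp only [show p + j + (n + 1) + 2 = p + 1 + q ↔ j + n + 2 = q by omega, mul_ite, mul_zero]

theorem productCoeff_succ_right (p q n : ℕ) : productCoeff p (q + 1) (n + 1) =
    productCoeff p q n +
      yVar q * ∑ i ∈ Finset.range p, if i + n + 2 = p then xVar i else 0 := by
  rw [productCoeff, productCoeff, Finset.mul_sum, ← Finset.sum_add_distrib]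
  refine Finset.sum_congr rfl fun i _ => ?_
  rw [Finset.sum_range_succ]
  congr 1
  · refine Finset.sum_congr rfl fun j _ => ?_
    simp only [show i + j + (n + 1) + 2 = p + (q + 1) ↔ i + j + n + 2 = p + q by omega]
  · simp only [show i + q + (n + 1) + 2 = p + (q + 1) ↔ i + n + 2 = p by omega, mul_ite, mul_zero,
      mul_comm]

theorem productCoeff_mem (p q n : ℕ) : productCoeff p q n ∈ spanLT xVar p * spanLT yVar q := by
  refine Submodule.sum_mem _ fun i hi => Submodule.sum_mem _ fun j hj => ?_
  rw [Finset.mem_range] at hi hj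
  split_ifs
  · exact Submodule.mul_mem_mul (mem_spanLT _ hi) (mem_spanLT _ hj)
  · exact zero_mem _

theorem mem_span_mul {u v : BiPoly} {V : Submodule ℝ BiPoly} (h : v ∈ V) :
    u * v ∈ Submodule.span ℝ {u} * V :=
  Submodule.mul_mem_mul (Submodule.mem_span_singleton_self u) h

theorem sum_ite_mem_spanLT (F : ℕ → BiPoly) (p : ℕ) (P : ℕ → Prop) [DecidablePred P] :
    (∑ i ∈ Finset.range p, if P i then F i else 0) ∈ spanLT F p := by
  refine Submodule.sum_mem _ fun i hi => ?_
  split_ifs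
  · exact mem_spanLT F (Finset.mem_range.1 hi)
  · exact zero_mem _

theorem spanLT_productCoeff_le_left (p q k : ℕ) : spanLT (productCoeff p q) k ≤
    spanLT (productCoeff (p + 1) q) (k + 1) + Submodule.span ℝ {xVar p} * spanLT yVar q := by
  refine spanLT_le fun n hn => ?_
  rw [← add_sub_cancel_right (productCoeff p q n) (xVar p * _), ← productCoeff_succ_left]
  exact Submodule.sub_mem _ (Submodule.mem_sup_left (mem_spanLT _ (by omega)))
    (Submodule.mem_sup_right (mem_span_mul (sum_ite_mem_spanLT _ _ _)))

theorem spanLT_productCoeff_le_right (p q k : ℕ) : spanLT (productCoeff p q) k ≤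
    spanLT (productCoeff p (q + 1)) (k + 1) + Submodule.span ℝ {yVar q} * spanLT xVar p := by
  refine spanLT_le fun n hn => ?_
  rw [← add_sub_cancel_right (productCoeff p q n) (yVar q * _), ← productCoeff_succ_right]
  exact Submodule.sub_mem _ (Submodule.mem_sup_left (mem_spanLT _ (by omega)))
    (Submodule.mem_sup_right (mem_span_mul (sum_ite_mem_spanLT _ _ _)))

theorem span_xVar_mul_span_yVar_le (p q k : ℕ) :
    Submodule.span ℝ {xVar p} * Submodule.span ℝ {yVar q} ≤
      spanLT (productCoeff (p + 1) (q + 1)) (k + 1) := by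
  rw [Submodule.span_mul_span, Set.singleton_mul_singleton, ← productCoeff_zero,
    Submodule.span_singleton_le_iff_mem]
  exact mem_spanLT _ (Nat.succ_pos k)

/-- Modulo the top coefficient `x p * y q`, the forms split into those without `x p` and the
multiples of `x p` without `y q`. -/
theorem biForms_le_of_le {p q k a b : ℕ} {C₁ C₂ : Submodule ℝ BiPoly}
    (h₁ : biForms p (q + 1) (a + 2) (b + 1) ≤
      spanLT (productCoeff p (q + 1)) k * biForms p (q + 1) (a + 1) b + C₁)
    (h₂ : biForms (p + 1) q (a + 1) (b + 1) ≤
      spanLT (productCoeff (p + 1) q) k * biForms (p + 1) q a b + C₂) :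
    biForms (p + 1) (q + 1) (a + 2) (b + 1) ≤
      spanLT (productCoeff (p + 1) (q + 1)) (k + 1) * biForms (p + 1) (q + 1) (a + 1) b +
        (C₁ + Submodule.span ℝ {xVar p} * C₂) := by
  set L := spanLT (productCoeff (p + 1) (q + 1)) (k + 1) with hL
  set x := Submodule.span ℝ {xVar p} with hx
  set y := Submodule.span ℝ {yVar q} with hy
  set X := spanLT xVar (p + 1) with hX
  set Y := spanLT yVar (q + 1) with hY
  set J := L * biForms (p + 1) (q + 1) (a + 1) b with hJ
  have hxX : x ≤ X := by
    rw [hx, Submodule.span_singleton_le_iff_mem]; exact mem_spanLT _ (Nat.lt_succ_self p)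
  have hxy : x * y ≤ L := span_xVar_mul_span_yVar_le p q k
  have hxT : x * biForms (p + 1) (q + 1) (a + 1) (b + 1) ≤ J + x * C₂ := by
    rw [biForms_succ_var_right, mul_add]
    refine sup_le ?_ ?_
    · calc x * biForms (p + 1) q (a + 1) (b + 1)
          ≤ x * ((L + y * X) * biForms (p + 1) (q + 1) a b + C₂) := by
            refine mul_le_mul' le_rfl (h₂.trans ?_)
            gcongr
            · exact spanLT_productCoeff_le_right _ _ _
            · exact biForms_mono _ _ le_rfl (Nat.le_succ q)
        _ = L * (x * biForms (p + 1) (q + 1) a b) +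
            (x * y) * (X * biForms (p + 1) (q + 1) a b) + x * C₂ := by ring
        _ ≤ L * (X * biForms (p + 1) (q + 1) a b) +
            L * (X * biForms (p + 1) (q + 1) a b) + x * C₂ := by gcongr
        _ = J + x * C₂ := by rw [add_idem, hJ, biForms_succ_left]
    · rw [← mul_assoc]
      exact (mul_le_mul' hxy le_rfl).trans le_self_add
  rw [biForms_succ_var_left]
  refine sup_le ?_ (hxT.trans ?_)
  · calc biForms p (q + 1) (a + 2) (b + 1)
        ≤ (L + x * Y) * biForms (p + 1) (q + 1) (a + 1) b + C₁ := by
          refine h₁.trans ?_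
          gcongr
          · exact spanLT_productCoeff_le_left _ _ _
          · exact biForms_mono _ _ (Nat.le_succ p) le_rfl
      _ = J + x * (Y * biForms (p + 1) (q + 1) (a + 1) b) + C₁ := by rw [hJ]; ring
      _ ≤ J + (J + x * C₂) + C₁ := by
          rw [← biForms_succ_right]
          gcongr
      _ = J + (C₁ + x * C₂) := by rw [← add_assoc, add_idem]; ring
  · gcongr
    exact le_add_self

theorem biForms_le_productCoeff_add (k : ℕ) : ∀ p q a b : ℕ, k ≤ a → k ≤ b →
    ∃ C : Submodule ℝ BiPoly, FiniteDimensional ℝ C ∧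
      (finrank ℝ C : ℤ) ≤ expectedCodim p q k (a + 1) (b + 1) ∧
      biForms p q (a + 1) (b + 1) ≤ spanLT (productCoeff p q) k * biForms p q a b + C := by
  induction k with
  | zero =>
    intro p q a b _ _
    refine ⟨biForms p q (a + 1) (b + 1), inferInstance, ?_, le_add_self⟩
    rw [finrank_biForms]
    push_cast; rfl
  | succ k ih =>
    intro p q a b ha hb
    rcases p with _ | p
    · refine ⟨⊥, inferInstance, ?_, ?_⟩
      · rw [expectedCodim_zero_left _ _ _ _ (by push_cast; omega)]; simp
      · rw [biForms_zero_left]; exact bot_le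
    rcases q with _ | q
    · refine ⟨⊥, inferInstance, ?_, ?_⟩
      · rw [expectedCodim_zero_right _ _ _ _ (by push_cast; omega)]; simp
      · rw [biForms_zero_right]; exact bot_le
    obtain ⟨a, rfl⟩ : ∃ n, a = n + 1 := ⟨a - 1, by omega⟩
    obtain ⟨C₁, _, hd₁, h₁⟩ := ih p (q + 1) (a + 1) b (by omega) (by omega)
    obtain ⟨C₂, _, hd₂, h₂⟩ := ih (p + 1) q a b (by omega) (by omega)
    refine ⟨C₁ + Submodule.span ℝ {xVar p} * C₂, ?_, ?_, biForms_le_of_le h₁ h₂⟩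
    · infer_instance
    · have hle : finrank ℝ ↥(Submodule.span ℝ {xVar p} * C₂) ≤ finrank ℝ C₂ := by
        have : Submodule.span ℝ {xVar p} * C₂ = C₂.map (LinearMap.mulLeft ℝ (xVar p)) := by
          ext w
          rw [Submodule.mem_span_singleton_mul]
          rfl
        rw [this]
        exact Submodule.finrank_map_le _ _
      have hsup := Submodule.finrank_add_le_finrank_add_finrank C₁
        (Submodule.span ℝ {xVar p} * C₂)
      rw [expectedCodim_succ_succ]
      push_cast at hd₁ ⊢
      rw [add_sub_cancel_right]
      rw [Submodule.add_eq_sup]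
      omega

/-- All but the constant coefficient of the product of two polynomials generate, together with
the constant coefficient `x 0` of the first factor, all forms of large bidegree. -/
theorem biForms_le_productCoeff_add_xVar (k : ℕ) : ∀ p q a b : ℕ, p + q ≤ k + 1 → k ≤ a →
    biForms (p + 1) q (a + 1) (b + 1) ≤
      spanLT (productCoeff (p + 1) q) k * biForms (p + 1) q a b +
        Submodule.span ℝ {xVar 0} * biForms (p + 1) q a (b + 1) := by
  induction k with
  | zero =>
    intro p q a b h _
    rcases p with _ | p
    · rw [biForms_succ_var_left, biForms_zero_left]
      exact sup_le bot_le le_add_self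
    · obtain rfl : q = 0 := by omega
      rw [biForms_zero_right]
      exact bot_le
  | succ k ih =>
    intro p q a b h ha
    rcases p with _ | p
    · rw [biForms_succ_var_left, biForms_zero_left]
      exact sup_le bot_le le_add_self
    rcases q with _ | q
    · rw [biForms_zero_right]
      exact bot_le
    obtain ⟨a, rfl⟩ : ∃ n, a = n + 1 := ⟨a - 1, by omega⟩
    refine (biForms_le_of_le (ih p (q + 1) (a + 1) b (by omega) (by omega))
      (ih (p + 1) q a b (by omega) (by omega))).trans ?_
    gcongr
    refine sup_le (mul_le_mul' le_rfl ?_) ?_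
    · exact biForms_mono _ _ (Nat.le_succ _) le_rfl
    · rw [mul_left_comm]
      refine mul_le_mul' le_rfl ?_
      rw [biForms_succ_left]
      refine mul_le_mul' ?_ (biForms_mono _ _ le_rfl (Nat.le_succ _))
      rw [Submodule.span_singleton_le_iff_mem]
      exact mem_spanLT _ (Nat.lt_succ_self _)

/-- Multiplication by a polynomial, as a linear map on a space of polynomials, summed over the
first `k` terms of a sequence. -/
def combine (F : ℕ → BiPoly) (k : ℕ) (T : Submodule ℝ BiPoly) : (Fin k → T) →ₗ[ℝ] BiPoly :=
  ∑ n : Fin k, LinearMap.mulLeft ℝ (F n) ∘ₗ T.subtype ∘ₗ LinearMap.proj n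

theorem combine_apply (F : ℕ → BiPoly) (k : ℕ) (T : Submodule ℝ BiPoly) (u : Fin k → T) :
    combine F k T u = ∑ n : Fin k, F n * u n := by
  simp [combine]

theorem range_combine (F : ℕ → BiPoly) (k : ℕ) (T : Submodule ℝ BiPoly) :
    (combine F k T).range = spanLT F k * T := by
  apply le_antisymm
  · rintro _ ⟨u, rfl⟩
    rw [combine_apply]
    exact Submodule.sum_mem _ fun n _ => Submodule.mul_mem_mul (mem_spanLT F n.2) (u n).2
  · rw [Submodule.mul_le]
    intro m hm t ht
    suffices h : spanLT F k ≤ (combine F k T).range.comap (LinearMap.mulRight ℝ t) from h hm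
    refine spanLT_le fun n hn => ⟨Pi.single ⟨n, hn⟩ ⟨t, ht⟩, ?_⟩
    rw [combine_apply, Finset.sum_eq_single ⟨n, hn⟩]
    · simp
    · intro i _ hi
      simp [Pi.single_eq_of_ne hi]
    · simp

theorem combine_add_smul (F G : ℕ → BiPoly) (t : ℝ) (k : ℕ) (T : Submodule ℝ BiPoly) :
    combine (F + t • G) k T = combine F k T + t • combine G k T := by
  refine LinearMap.ext fun u => ?_
  simp [combine_apply, add_mul, Finset.sum_add_distrib, Finset.smul_sum]

theorem eventually_finrank_add_spanLT_mul_le (F G : ℕ → BiPoly) (k : ℕ)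
    (U T : Submodule ℝ BiPoly) [FiniteDimensional ℝ U] [FiniteDimensional ℝ T] :
    ∀ᶠ t in 𝓝[≠] (0 : ℝ), finrank ℝ ↥(U + spanLT G k * T) ≤
      finrank ℝ ↥(U + spanLT (F + t • G) k * T) := by
  filter_upwards [eventually_finrank_sup_range_le (combine F k T) (combine G k T) U] with t ht
  rwa [← combine_add_smul, range_combine, range_combine] at ht

/-- Adding one more generator of bidegree `(1, 1)` decreases the codimension in bidegree
`(a + 2, b + 2)` by at most the codimension in bidegree `(a + 1, b + 1)`. -/
theorem finrank_spanLT_succ_mul_le (F : ℕ → BiPoly) {p q : ℕ}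
    (hF : ∀ n, F n ∈ spanLT xVar p * spanLT yVar q) (k a b : ℕ) :
    finrank ℝ ↥(spanLT F (k + 1) * biForms p q (a + 1) (b + 1)) +
        finrank ℝ ↥(spanLT F k * biForms p q a b) ≤
      finrank ℝ ↥(spanLT F k * biForms p q (a + 1) (b + 1)) +
        finrank ℝ (biForms p q (a + 1) (b + 1)) := by
  set T := biForms p q (a + 1) (b + 1) with hT
  set J := spanLT F k * T with hJ
  set J₀ := spanLT F k * biForms p q a b with hJ₀
  have hT' : T = spanLT xVar p * spanLT yVar q * biForms p q a b := by
    rw [hT, biForms_succ_left, biForms_succ_right, mul_assoc]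
  have hJ₀T : J₀ ≤ T := by
    rw [hT']
    exact mul_le_mul' (spanLT_le fun n _ => hF n) le_rfl
  have hsucc : spanLT F (k + 1) * T = J ⊔ Submodule.span ℝ {F k} * T := by
    rw [spanLT_succ, add_mul, Submodule.add_eq_sup]
  by_cases h0 : F k = 0
  · have : spanLT F (k + 1) * T = J := by
      rw [hsucc, h0]; simp
    rw [this]
    exact Nat.add_le_add_left (Submodule.finrank_mono hJ₀T) _
  have hfin : ∀ V : Submodule ℝ BiPoly,
      finrank ℝ ↥(Submodule.span ℝ {F k} * V) = finrank ℝ V := fun V =>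
    finrank_span_singleton_mul h0 V
  have hinf : Submodule.span ℝ {F k} * J₀ ≤ J ⊓ Submodule.span ℝ {F k} * T := by
    refine le_inf ?_ (mul_le_mul' le_rfl hJ₀T)
    rw [hJ₀, hJ, hT', mul_left_comm]
    refine mul_le_mul' le_rfl (mul_le_mul' ?_ le_rfl)
    rw [Submodule.span_singleton_le_iff_mem]
    exact hF k
  have h1 := Submodule.finrank_sup_add_finrank_inf_eq J (Submodule.span ℝ {F k} * T)
  have h2 := Submodule.finrank_mono hinf
  rw [hfin] at h1 h2
  rw [hsucc]
  omega

theorem spanLT_mul_biForms_le {F : ℕ → BiPoly} {p q : ℕ}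
    (hF : ∀ n, F n ∈ spanLT xVar p * spanLT yVar q) (k a b : ℕ) :
    spanLT F k * biForms p q a b ≤ biForms p q (a + 1) (b + 1) := by
  rw [biForms_succ_left, biForms_succ_right, ← mul_assoc]
  exact mul_le_mul' (spanLT_le fun n _ => hF n) le_rfl

/-- For a small perturbation of any forms of bidegree `(1, 1)`, the generated ideal has the
expected codimension in any given bidegree. -/
theorem eventually_finrank_eq (F : ℕ → BiPoly) {p q : ℕ}
    (hF : ∀ n, F n ∈ spanLT xVar p * spanLT yVar q) (k : ℕ) : ∀ a b : ℕ, k ≤ a → k ≤ b →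
    ∀ᶠ t in 𝓝[≠] (0 : ℝ), (finrank ℝ (biForms p q (a + 1) (b + 1)) : ℤ) =
      finrank ℝ ↥(spanLT (F + t • productCoeff p q) k * biForms p q a b) +
        expectedCodim p q k (a + 1) (b + 1) := by
  have hFt : ∀ t n, (F + t • productCoeff p q) n ∈ spanLT xVar p * spanLT yVar q := fun t n =>
    add_mem (hF n) (Submodule.smul_mem _ t (productCoeff_mem p q n))
  induction k with
  | zero =>
    intro a b _ _
    refine Filter.Eventually.of_forall fun t => ?_
    rw [spanLT_zero, Submodule.bot_mul, finrank_bot, finrank_biForms]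
    push_cast; ring
  | succ k ih =>
    intro a b ha hb
    obtain ⟨a, rfl⟩ : ∃ n, a = n + 1 := ⟨a - 1, by omega⟩
    obtain ⟨b, rfl⟩ : ∃ n, b = n + 1 := ⟨b - 1, by omega⟩
    filter_upwards [ih (a + 1) (b + 1) (by omega) (by omega), ih a b (by omega) (by omega),
      eventually_finrank_add_spanLT_mul_le F (productCoeff p q) (k + 1) ⊥
        (biForms p q (a + 1) (b + 1))] with t h1 h2 h3
    rw [Submodule.add_eq_sup, Submodule.add_eq_sup, bot_sup_eq, bot_sup_eq] at h3
    have h4 := finrank_spanLT_succ_mul_le _ (hFt t) k a b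
    obtain ⟨C, _, hd, hC⟩ := biForms_le_productCoeff_add (k + 1) p q (a + 1) (b + 1) ha hb
    have h5 := (Submodule.finrank_mono hC).trans (Submodule.finrank_add_le_finrank_add_finrank _ _)
    rw [expectedCodim] at hd ⊢
    push_cast at h1 h2 hd ⊢
    rw [add_sub_cancel_right, add_sub_cancel_right] at hd ⊢
    omega

/-- For a small perturbation of any `p + q - 1` forms of bidegree `(1, 1)`, the variable `x 0` is
not a zero divisor: it generates everything modulo the forms. -/
theorem eventually_biForms_le (F : ℕ → BiPoly) {p q : ℕ}
    (hF : ∀ n, F n ∈ spanLT xVar (p + 1) * spanLT yVar q) (k a b : ℕ) (hk : p + q ≤ k + 1)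
    (ha : k ≤ a) :
    ∀ᶠ t in 𝓝[≠] (0 : ℝ), biForms (p + 1) q (a + 1) (b + 1) ≤
      Submodule.span ℝ {xVar 0} * biForms (p + 1) q a (b + 1) +
        spanLT (F + t • productCoeff (p + 1) q) k * biForms (p + 1) q a b := by
  filter_upwards [eventually_finrank_add_spanLT_mul_le F (productCoeff (p + 1) q) k
    (Submodule.span ℝ {xVar 0} * biForms (p + 1) q a (b + 1)) (biForms (p + 1) q a b)] with t ht
  have h1 := Submodule.finrank_mono (biForms_le_productCoeff_add_xVar k p q a b hk ha)
  rw [add_comm (spanLT _ _ * _)] at h1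
  refine (Submodule.eq_of_le_of_finrank_le (sup_le ?_ ?_) (h1.trans ht)).ge
  · rw [biForms_succ_left]
    refine mul_le_mul' ?_ le_rfl
    rw [Submodule.span_singleton_le_iff_mem]
    exact mem_spanLT _ (Nat.succ_pos _)
  · exact spanLT_mul_biForms_le (fun n =>
      add_mem (hF n) (Submodule.smul_mem _ t (productCoeff_mem _ q n))) k a b

/-- Multiplication operators between three spaces of the same odd dimension, one of which is
bijective, have a common eigenfunctional. -/
theorem exists_eigenfunctional {ι M₀ M₁ M₂ : Type*} [AddCommGroup M₀] [Module ℝ M₀]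
    [FiniteDimensional ℝ M₀] [AddCommGroup M₁] [Module ℝ M₁] [FiniteDimensional ℝ M₁]
    [AddCommGroup M₂] [Module ℝ M₂] [FiniteDimensional ℝ M₂]
    (hodd : Odd (finrank ℝ M₀)) (h₁ : finrank ℝ M₁ = finrank ℝ M₀)
    (h₂ : finrank ℝ M₂ = finrank ℝ M₀) (X : ι → M₀ →ₗ[ℝ] M₁) (X' : ι → M₁ →ₗ[ℝ] M₂)
    (hX : ∀ i j m, X' i (X j m) = X' j (X i m)) (i₀ : ι)
    (hs : Function.Surjective (X i₀)) (hs' : Function.Surjective (X' i₀)) :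
    ∃ (ψ : M₁ →ₗ[ℝ] ℝ) (c : ι → ℝ), ψ ≠ 0 ∧ ∀ i m, ψ (X i m) = c i * ψ (X i₀ m) := by
  have hinj : Function.Injective (X i₀) :=
    (LinearMap.injective_iff_surjective_of_finrank_eq_finrank h₁.symm).2 hs
  have hinj' : Function.Injective (X' i₀) :=
    (LinearMap.injective_iff_surjective_of_finrank_eq_finrank (h₁.trans h₂.symm)).2 hs'
  set e := LinearEquiv.ofBijective (X i₀) ⟨hinj, hs⟩ with he
  have hXe : ∀ m, X i₀ (e.symm m) = m := e.apply_symm_apply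
  have heX : ∀ m, e.symm (X i₀ m) = m := e.symm_apply_apply
  set Y : ι → End ℝ M₀ := fun i => e.symm.toLinearMap ∘ₗ X i with hY
  have hXY : ∀ i m, X i₀ (Y i m) = X i m := fun i m => hXe _
  have hcomm : ∀ i j m, Y i (Y j m) = Y j (Y i m) := by
    intro i j m
    apply hinj
    apply hinj'
    rw [hXY, hXY, hX i₀ i, hX i₀ j, hXY, hXY, hX i j]
  obtain ⟨φ, c, hφ, hc⟩ := exists_common_eigenvector_of_odd (V := Dual ℝ M₀) _ rfl
    (by rwa [Subspace.dual_finrank_eq]) (fun i => (Y i).dualMap) (by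
      intro i j
      refine LinearMap.ext fun φ => LinearMap.ext fun m => ?_
      exact congrArg φ (hcomm j i m))
  refine ⟨φ ∘ₗ e.symm.toLinearMap, c, ?_, fun i m => ?_⟩
  · intro h
    refine hφ (LinearMap.ext fun m => ?_)
    have := LinearMap.congr_fun h (X i₀ m)
    simpa [heX] using this
  · have := LinearMap.congr_fun (hc i) m
    simpa [heX, hY] using this

/-- A version of `exists_eigenfunctional` for multiplication by variables on subquotients
`T / J` of the polynomial ring. -/
theorem exists_eigenfunctional_biPoly {D P : ℕ} (hD : Odd D)
    (T₀ T₁ T₂ J₀ J₁ J₂ : Submodule ℝ BiPoly) [FiniteDimensional ℝ T₀] [FiniteDimensional ℝ T₁]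
    [FiniteDimensional ℝ T₂] (hJ₀ : J₀ ≤ T₀) (hJ₁ : J₁ ≤ T₁) (hJ₂ : J₂ ≤ T₂)
    (hd₀ : finrank ℝ T₀ = finrank ℝ J₀ + D) (hd₁ : finrank ℝ T₁ = finrank ℝ J₁ + D)
    (hd₂ : finrank ℝ T₂ = finrank ℝ J₂ + D) (hT₀ : spanLT xVar (P + 1) * T₀ ≤ T₁)
    (hT₁ : spanLT xVar (P + 1) * T₁ ≤ T₂) (hJT₀ : spanLT xVar (P + 1) * J₀ ≤ J₁)
    (hJT₁ : spanLT xVar (P + 1) * J₁ ≤ J₂) (hs₁ : T₁ ≤ Submodule.span ℝ {xVar 0} * T₀ + J₁)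
    (hs₂ : T₂ ≤ Submodule.span ℝ {xVar 0} * T₁ + J₂) :
    ∃ (ψ : BiPoly →ₗ[ℝ] ℝ) (c : ℕ → ℝ), ¬ T₁ ≤ ψ.ker ∧ J₁ ≤ ψ.ker ∧
      ∀ i < P + 1, ∀ m ∈ T₀, ψ (xVar i * m) = c i * ψ (xVar 0 * m) := by
  have hfin : ∀ (T J : Submodule ℝ BiPoly) [FiniteDimensional ℝ T], J ≤ T →
      finrank ℝ T = finrank ℝ J + D → finrank ℝ (T ⧸ J.submoduleOf T) = D := by
    intro T J _ hJ hd
    have h1 := (J.submoduleOf T).finrank_quotient_add_finrank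
    have h2 := (Submodule.submoduleOfEquivOfLe hJ).finrank_eq
    omega
  have hmul : ∀ {S U : Submodule ℝ BiPoly}, spanLT xVar (P + 1) * S ≤ U →
      ∀ i : Fin (P + 1), ∀ m ∈ S, LinearMap.mulLeft ℝ (xVar i) m ∈ U := fun h i m hm =>
    h (Submodule.mul_mem_mul (mem_spanLT _ i.2) hm)
  set X : Fin (P + 1) → (T₀ ⧸ J₀.submoduleOf T₀) →ₗ[ℝ] (T₁ ⧸ J₁.submoduleOf T₁) := fun i =>
    Submodule.mapQ _ _ ((LinearMap.mulLeft ℝ (xVar i)).restrict (hmul hT₀ i))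
      (fun m hm => hmul hJT₀ i m hm) with hX
  set X' : Fin (P + 1) → (T₁ ⧸ J₁.submoduleOf T₁) →ₗ[ℝ] (T₂ ⧸ J₂.submoduleOf T₂) := fun i =>
    Submodule.mapQ _ _ ((LinearMap.mulLeft ℝ (xVar i)).restrict (hmul hT₁ i))
      (fun m hm => hmul hJT₁ i m hm) with hX'
  have hsurj : ∀ {S U I K : Submodule ℝ BiPoly} (f : S →ₗ[ℝ] U)
      (hf : ∀ m, (f m : BiPoly) = xVar 0 * m)
      (hIK : I.submoduleOf S ≤ (K.submoduleOf U).comap f)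
      (_ : U ≤ Submodule.span ℝ {xVar 0} * S + K),
      Function.Surjective (Submodule.mapQ _ _ f hIK) := by
    intro S U I K f hf hIK h u
    obtain ⟨u, rfl⟩ := Submodule.Quotient.mk_surjective _ u
    obtain ⟨v, hv, k, hk, hvk⟩ := Submodule.mem_sup.1 (h u.2)
    obtain ⟨m, hm, rfl⟩ := Submodule.mem_span_singleton_mul.1 hv
    refine ⟨Submodule.Quotient.mk ⟨m, hm⟩, ?_⟩
    rw [Submodule.mapQ_apply, Submodule.Quotient.eq, Submodule.submoduleOf,
      Submodule.mem_comap, Submodule.subtype_apply]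
    rw [AddSubgroupClass.coe_sub, hf, ← hvk]
    simpa using hk
  obtain ⟨ψ, c, hψ, hc⟩ := exists_eigenfunctional (by rwa [hfin T₀ J₀ hJ₀ hd₀])
    ((hfin T₁ J₁ hJ₁ hd₁).trans (hfin T₀ J₀ hJ₀ hd₀).symm)
    ((hfin T₂ J₂ hJ₂ hd₂).trans (hfin T₀ J₀ hJ₀ hd₀).symm) X X' (by
      intro i j m
      obtain ⟨m, rfl⟩ := Submodule.Quotient.mk_surjective _ m
      refine congrArg (Submodule.Quotient.mk (p := J₂.submoduleOf T₂)) (Subtype.ext ?_)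
      exact mul_left_comm _ _ _) 0
    (hsurj _ (fun _ => rfl) _ hs₁) (hsurj _ (fun _ => rfl) _ hs₂)
  obtain ⟨Ψ, hΨ⟩ := LinearMap.exists_extend (ψ ∘ₗ (J₁.submoduleOf T₁).mkQ)
  have hΨ' : ∀ m (hm : m ∈ T₁), Ψ m = ψ (Submodule.Quotient.mk ⟨m, hm⟩) := fun m hm =>
    LinearMap.congr_fun hΨ ⟨m, hm⟩
  refine ⟨Ψ, fun i => if h : i < P + 1 then c ⟨i, h⟩ else 0, ?_, ?_, ?_⟩
  · intro h
    refine hψ (LinearMap.ext fun m => ?_)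
    obtain ⟨m, rfl⟩ := Submodule.Quotient.mk_surjective _ m
    rw [← hΨ' m m.2]
    exact h m.2
  · intro m hm
    rw [LinearMap.mem_ker, hΨ' m (hJ₁ hm), (Submodule.Quotient.mk_eq_zero _).2, map_zero]
    exact hm
  · intro i hi m hm
    beta_reduce
    rw [dif_pos hi, hΨ' (xVar i * m) (hmul hT₀ ⟨i, hi⟩ m hm),
      hΨ' (xVar 0 * m) (hmul hT₀ 0 m hm)]
    exact hc ⟨i, hi⟩ (Submodule.Quotient.mk ⟨m, hm⟩)

/-- The forms of bidegree `(1, 1)` with given coefficients. -/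
def bilinForm (p q : ℕ) (φ : ℕ → ℕ → ℕ → ℝ) (n : ℕ) : BiPoly :=
  ∑ i ∈ Finset.range p, ∑ j ∈ Finset.range q, φ n i j • (xVar i * yVar j)

theorem bilinForm_mem (p q : ℕ) (φ : ℕ → ℕ → ℕ → ℝ) (n : ℕ) :
    bilinForm p q φ n ∈ spanLT xVar p * spanLT yVar q :=
  Submodule.sum_mem _ fun _ hi => Submodule.sum_mem _ fun _ hj => Submodule.smul_mem _ _
    (Submodule.mul_mem_mul (mem_spanLT _ (Finset.mem_range.1 hi))
      (mem_spanLT _ (Finset.mem_range.1 hj)))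

/-- The coefficients of `productCoeff`. -/
def productCoeffCoeff (p q n i j : ℕ) : ℝ := if i + j + n + 2 = p + q then 1 else 0

theorem bilinForm_add_smul (p q : ℕ) (φ : ℕ → ℕ → ℕ → ℝ) (t : ℝ) :
    bilinForm p q (φ + t • productCoeffCoeff p q) = bilinForm p q φ + t • productCoeff p q := by
  ext1 n
  simp only [bilinForm, productCoeff, productCoeffCoeff, Pi.add_apply, Pi.smul_apply, add_smul,
    Finset.sum_add_distrib, Finset.smul_sum, smul_eq_mul, mul_ite, mul_one, mul_zero, ite_smul,
    zero_smul, smul_ite, smul_zero]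

/-- A small perturbation of any `p + q` bilinear forms on `ℝ ^ (p + 1) × ℝ ^ (q + 1)` has a
nontrivial common zero if `(p + q).choose p` is odd. -/
theorem eventually_exists_zero {p q : ℕ} (hodd : Odd ((p + q).choose p))
    (φ : ℕ → ℕ → ℕ → ℝ) :
    ∀ᶠ t in 𝓝[≠] (0 : ℝ), ∃ x y : ℕ → ℝ, (∃ i < p + 1, x i ≠ 0) ∧ (∃ j < q + 1, y j ≠ 0) ∧
      ∀ n < p + q, ∑ i ∈ Finset.range (p + 1), ∑ j ∈ Finset.range (q + 1),
        (φ + t • productCoeffCoeff (p + 1) (q + 1)) n i j * (x i * y j) = 0 := by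
  have hF := bilinForm_mem (p + 1) (q + 1) φ
  set k := p + q with hk
  have hdim := fun a ha => eventually_finrank_eq _ hF k a k ha le_rfl
  filter_upwards [hdim k le_rfl, hdim (k + 1) (by omega), hdim (k + 2) (by omega),
    eventually_biForms_le _ hF k (k + 1) k (by omega) (by omega),
    eventually_biForms_le _ hF k (k + 2) k (by omega) (by omega)] with t h₀ h₁ h₂ hs₁ hs₂
  rw [← bilinForm_add_smul] at h₀ h₁ h₂ hs₁ hs₂
  set φ' := φ + t • productCoeffCoeff (p + 1) (q + 1)
  have hF' := bilinForm_mem (p + 1) (q + 1) φ'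
  set L := spanLT (bilinForm (p + 1) (q + 1) φ') k with hL
  rw [expectedCodim_add k p q _ _ rfl (by omega) (by omega)] at h₀ h₁ h₂
  have hJ : ∀ a, spanLT xVar (p + 1) * (L * biForms (p + 1) (q + 1) a k) ≤
      L * biForms (p + 1) (q + 1) (a + 1) k := fun a => by
    rw [mul_left_comm, ← biForms_succ_left]
  obtain ⟨ψ, c, hψ, hJψ, hc⟩ := exists_eigenfunctional_biPoly hodd _ _ _ _ _ _
    (spanLT_mul_biForms_le hF' k _ _) (spanLT_mul_biForms_le hF' k _ _)
    (spanLT_mul_biForms_le hF' k _ _) (by exact_mod_cast h₀) (by exact_mod_cast h₁)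
    (by exact_mod_cast h₂) (biForms_succ_left _ _ _ _).ge (biForms_succ_left _ _ _ _).ge
    (hJ _) (hJ _) hs₁ hs₂
  rw [biForms_succ_left, biForms_succ_right] at hψ
  obtain ⟨i, hi, j, hj, u, hu, hne⟩ : ∃ i < p + 1, ∃ j < q + 1,
      ∃ u ∈ biForms (p + 1) (q + 1) (k + 1) k, ψ (xVar i * (yVar j * u)) ≠ 0 := by
    by_contra! h
    refine hψ ?_
    rw [← mul_assoc, Submodule.mul_le]
    intro m hm u hu
    suffices spanLT xVar (p + 1) * spanLT yVar (q + 1) ≤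
      ψ.ker.comap (LinearMap.mulRight ℝ u) from this hm
    rw [Submodule.mul_le]
    intro x hx y hy
    suffices spanLT yVar (q + 1) ≤ ψ.ker.comap (LinearMap.mulRight ℝ u ∘ₗ LinearMap.mulLeft ℝ x)
      from this hy
    refine spanLT_le fun j hj => ?_
    suffices spanLT xVar (p + 1) ≤ ψ.ker.comap (LinearMap.mulRight ℝ (yVar j * u)) by
      have := this hx
      simpa [mul_assoc] using this
    exact spanLT_le fun i hi => h i hi j hj u hu
  have hyu : ∀ j < q + 1, yVar j * u ∈ biForms (p + 1) (q + 1) (k + 1) (k + 1) := fun j hj => by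
    rw [biForms_succ_right]
    exact Submodule.mul_mem_mul (mem_spanLT _ hj) hu
  rw [hc i hi _ (hyu j hj)] at hne
  refine ⟨c, fun j => ψ (xVar 0 * (yVar j * u)), ⟨i, hi, left_ne_zero_of_mul hne⟩,
    ⟨j, hj, right_ne_zero_of_mul hne⟩, fun n hn => ?_⟩
  have h0 : ψ (bilinForm (p + 1) (q + 1) φ' n * u) = 0 :=
    hJψ (Submodule.mul_mem_mul (mem_spanLT _ hn) hu)
  rw [← h0, bilinForm, Finset.sum_mul, map_sum]
  refine Finset.sum_congr rfl fun i hi => ?_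
  rw [Finset.sum_mul, map_sum]
  refine Finset.sum_congr rfl fun j hj => ?_
  rw [← hc i (Finset.mem_range.1 hi) _ (hyu j (Finset.mem_range.1 hj)), smul_mul_assoc, map_smul,
    smul_eq_mul, mul_assoc (xVar i)]

/-- If `(p + q).choose p` is odd, then `p + q` real bilinear forms on `ℝ ^ (p + 1) × ℝ ^ (q + 1)`
have a nontrivial common zero. -/
theorem exists_common_zero {p q : ℕ} (hodd : Odd ((p + q).choose p)) (φ : ℕ → ℕ → ℕ → ℝ) :
    ∃ (x : Fin (p + 1) → ℝ) (y : Fin (q + 1) → ℝ), x ≠ 0 ∧ y ≠ 0 ∧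
      ∀ n < p + q, ∑ i : Fin (p + 1), ∑ j : Fin (q + 1), φ n i j * (x i * y j) = 0 := by
  by_contra! hcon
  set h : ℝ → (Fin (p + 1) → ℝ) × (Fin (q + 1) → ℝ) → Fin (p + q) → ℝ := fun t z n =>
    ∑ i : Fin (p + 1), ∑ j : Fin (q + 1),
      (φ + t • productCoeffCoeff (p + 1) (q + 1)) n i j * (z.1 i * z.2 j) with hh
  have hcont : Continuous (Function.uncurry h) := by
    simp only [hh, Function.uncurry_def, Pi.add_apply, Pi.smul_apply, smul_eq_mul]
    fun_prop
  have hev : ∀ᶠ t in 𝓝 (0 : ℝ), ∀ z ∈ Metric.sphere (0 : Fin (p + 1) → ℝ) 1 ×ˢ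
      Metric.sphere (0 : Fin (q + 1) → ℝ) 1, h t z ≠ 0 := by
    refine ((isCompact_sphere _ _).prod
      (isCompact_sphere _ _)).eventually_forall_of_forall_eventually fun z hz => ?_
    refine hcont.continuousAt.eventually_ne fun h0 => ?_
    obtain ⟨n, hn, hne⟩ := hcon z.1 z.2 (ne_zero_of_mem_unit_sphere ⟨z.1, hz.1⟩)
      (ne_zero_of_mem_unit_sphere ⟨z.2, hz.2⟩)
    refine hne ?_
    simpa [h] using congrFun h0 ⟨n, hn⟩
  obtain ⟨t, ht, x, y, ⟨i, hi, hx⟩, ⟨j, hj, hy⟩, hxy⟩ :=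
    ((hev.filter_mono nhdsWithin_le_nhds).and (eventually_exists_zero hodd φ)).exists
  set x' : Fin (p + 1) → ℝ := fun i => x i
  set y' : Fin (q + 1) → ℝ := fun j => y j
  have hx' : x' ≠ 0 := fun h0 => hx (congrFun h0 ⟨i, hi⟩)
  have hy' : y' ≠ 0 := fun h0 => hy (congrFun h0 ⟨j, hj⟩)
  refine ht (‖x'‖⁻¹ • x', ‖y'‖⁻¹ • y') ⟨?_, ?_⟩ (funext fun n => ?_)
  · simp [norm_smul, hx']
  · simp [norm_smul, hy']
  · have h0 := hxy n n.2
    simp only [Finset.sum_range] at h0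
    calc h t (‖x'‖⁻¹ • x', ‖y'‖⁻¹ • y') n = ‖x'‖⁻¹ * ‖y'‖⁻¹ * ∑ i : Fin (p + 1),
          ∑ j : Fin (q + 1), (φ + t • productCoeffCoeff (p + 1) (q + 1)) n i j * (x i * y j) := by
          simp only [hh, Finset.mul_sum, Pi.smul_apply _ x', Pi.smul_apply _ y', smul_eq_mul]
          refine Finset.sum_congr rfl fun i _ => Finset.sum_congr rfl fun j _ => ?_
          ring
      _ = 0 := by rw [h0, mul_zero]

theorem odd_choose_two_pow_sub_one (m j : ℕ) (hj : j ≤ 2 ^ m - 1) : Odd ((2 ^ m - 1).choose j) := by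
  induction j with
  | zero => simp
  | succ j ih =>
    have h := Nat.prime_two.dvd_choose_pow (n := m) (k := j + 1) (by omega) (by omega)
    rw [show 2 ^ m = 2 ^ m - 1 + 1 by omega, Nat.choose_succ_succ', ← even_iff_two_dvd,
      Nat.even_add'] at h
    exact h.1 (ih (by omega))

/-- If `(p + q).choose p` is odd, then every bilinear map `ℝ ^ a × ℝ ^ b → ℝ ^ k` with `p < a`,
`q < b` and `k ≤ p + q` is singular. -/
theorem not_nonsingular {p q a b k : ℕ} (hodd : Odd ((p + q).choose p)) (ha : p + 1 ≤ a)
    (hb : q + 1 ≤ b) (hk : k ≤ p + q) {f : (Fin a → ℝ) → (Fin b → ℝ) → (Fin k → ℝ)}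
    (hf : IsBilin ℝ f) : ¬ Nonsingular f := by
  intro hns
  set B := LinearMap.mk₂ ℝ f hf.1 hf.2.1 hf.2.2.1 hf.2.2.2 with hB
  set u : Fin (p + 1) → Fin a → ℝ := fun i => Pi.basisFun ℝ _ (Fin.castLE ha i) with hu
  set v : Fin (q + 1) → Fin b → ℝ := fun j => Pi.basisFun ℝ _ (Fin.castLE hb j) with hv
  have hui : LinearIndependent ℝ u :=
    (Pi.basisFun ℝ _).linearIndependent.comp _ (Fin.castLE_injective ha)
  have hvi : LinearIndependent ℝ v :=
    (Pi.basisFun ℝ _).linearIndependent.comp _ (Fin.castLE_injective hb)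
  obtain ⟨x, y, hx, hy, hxy⟩ := exists_common_zero hodd fun n i j =>
    if h : n < k ∧ i < p + 1 ∧ j < q + 1 then B (u ⟨i, h.2.1⟩) (v ⟨j, h.2.2⟩) ⟨n, h.1⟩ else 0
  have h0 : B (∑ i, x i • u i) (∑ j, y j • v j) = 0 := by
    ext n
    refine Eq.trans ?_ (hxy n (n.2.trans_le hk))
    rw [LinearMap.map_sum₂, Finset.sum_apply]
    refine Finset.sum_congr rfl fun i _ => ?_
    rw [map_sum, Finset.sum_apply]
    refine Finset.sum_congr rfl fun j _ => ?_
    rw [dif_pos ⟨n.2, i.2, j.2⟩, LinearMap.map_smul₂, map_smul]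
    simp only [Pi.smul_apply, smul_eq_mul, Fin.eta]
    ring
  rcases hns _ _ h0 with h | h
  · exact hx (funext (Fintype.linearIndependent_iff.1 hui x h))
  · exact hy (funext (Fintype.linearIndependent_iff.1 hvi y h))

end

/-- If there exists a nonsingular bilinear map `ℝ^d × ℝ^d → ℝ^k`, then
`k ≥ 2 ^ ⌈log₂ d⌉`. -/
theorem statement_7 (d k : ℕ) (hd : 1 ≤ d) (hk : 1 ≤ k)
    (f : (Fin d → ℝ) → (Fin d → ℝ) → (Fin k → ℝ))
    (hbil : IsBilin ℝ f) (hns : Nonsingular f) :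
    2 ^ Nat.clog 2 d ≤ k := by
  cases hm : Nat.clog 2 d with
  | zero => rwa [pow_zero]
  | succ m =>
  by_contra! hlt
  have hd' : 2 ^ m < d := Nat.pow_lt_of_lt_clog (by omega)
  have hpos : 0 < 2 ^ m := by positivity
  have hpow := pow_succ 2 m
  have hsum : 2 ^ m + (2 ^ m - 1) = 2 ^ (m + 1) - 1 := by omega
  refine not_nonsingular (p := 2 ^ m) (q := 2 ^ m - 1) ?_ hd' (by omega) (by omega) hbil hns
  rw [hsum]
  exact odd_choose_two_pow_sub_one _ _ (by omega)
end
end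

section
/- Let K be a field and d, r ≥ 1. If there exists a nonsingular bilinear map f : K^d × K^d → K^r, then for every n ≥ 1 there exists a nonsingular bilinear map h : K^{nd} × K^{nd} → K^{(2n−1)r}; explicitly, identifying K^{nd} with n-tuples (x_1,…,x_n) of vectors in K^d, the map h((x_1,…,x_n),(y_1,…,y_n))_l = Σ_{i+j=l} f(x_i, y_j) is nonsingular. Consequently g_K(nd) ≤ (2n−1) g_K(d). -/
noncomputable section

/-- Given `f : K^d × K^d → K^r`, the "polynomial multiplication" extension
`h : (K^d)^n × (K^d)^n → (K^r)^{2n−1}`, `h(x, y)_l = Σ_{i+j=l} f(x_i, y_j)`. -/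
def tupleConv (K : Type*) [Field K] {d r : ℕ}
    (f : (Fin d → K) → (Fin d → K) → (Fin r → K)) (n : ℕ) :
    (Fin n → Fin d → K) → (Fin n → Fin d → K) → (Fin (2 * n - 1) → Fin r → K) :=
  fun x y l => ∑ i : Fin n, ∑ j : Fin n,
    if (i : ℕ) + (j : ℕ) = (l : ℕ) then f (x i) (y j) else 0

theorem IsBilin.map_zero_left {K E F G : Type*} [Field K] [AddCommGroup E] [AddCommGroup F]
    [AddCommGroup G] [Module K E] [Module K F] [Module K G] {f : E → F → G}
    (hf : IsBilin K f) (y : F) : f 0 y = 0 := by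
  simpa using hf.2.1 0 0 y

theorem IsBilin.map_zero_right {K E F G : Type*} [Field K] [AddCommGroup E] [AddCommGroup F]
    [AddCommGroup G] [Module K E] [Module K F] [Module K G] {f : E → F → G}
    (hf : IsBilin K f) (x : E) : f x 0 = 0 := by
  simpa using hf.2.2.2 0 x 0

/-- A nonzero tuple has a first nonzero entry. -/
theorem exists_first_ne_zero {M : Type*} [Zero M] {n : ℕ} {x : Fin n → M} (hx : x ≠ 0) :
    ∃ i, x i ≠ 0 ∧ ∀ j < i, x j = 0 := by
  obtain ⟨i, hi, hmin⟩ := WellFounded.has_min (wellFounded_lt (α := Fin n)) {i | x i ≠ 0}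
    (Function.ne_iff.mp hx)
  exact ⟨i, hi, fun j hj => by_contra fun h => hmin j h hj⟩

/-- As for a product of polynomials, the lowest nonzero terms of `x` and `y` determine the lowest
nonzero term of `tupleConv K f n x y`. -/
theorem nonsingular_tupleConv {K : Type*} [Field K] {d r : ℕ}
    {f : (Fin d → K) → (Fin d → K) → (Fin r → K)} (hf : IsBilin K f) (hns : Nonsingular f)
    (n : ℕ) : Nonsingular (tupleConv K f n) := by
  intro x y h
  by_contra! hxy
  obtain ⟨i₀, hi₀, hi⟩ := exists_first_ne_zero hxy.1
  obtain ⟨j₀, hj₀, hj⟩ := exists_first_ne_zero hxy.2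
  have hl : (i₀ : ℕ) + j₀ < 2 * n - 1 := by omega
  have hvanish : ∀ i j : Fin n, (i : ℕ) + j = i₀ + j₀ → i ≠ i₀ ∨ j ≠ j₀ →
      f (x i) (y j) = 0 := by
    intro i j hij hne
    rcases lt_or_ge i i₀ with hlt | hge
    · rw [hi i hlt, hf.map_zero_left]
    · rw [hj j (by omega), hf.map_zero_right]
  have hcoeff : tupleConv K f n x y ⟨i₀ + j₀, hl⟩ = f (x i₀) (y j₀) := by
    unfold tupleConv
    rw [Finset.sum_eq_single i₀ _ (by simp), Finset.sum_eq_single j₀ _ (by simp)]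
    · simp
    · intro j _ hne
      exact ite_eq_right_iff.mpr fun hij => hvanish i₀ j hij (Or.inr hne)
    · intro i _ hne
      exact Finset.sum_eq_zero fun j _ =>
        ite_eq_right_iff.mpr fun hij => hvanish i j hij (Or.inl hne)
  exact (hns _ _ (hcoeff.symm.trans (congrFun h _))).elim hi₀ hj₀

theorem isBilin_tupleConv {K : Type*} [Field K] {d r : ℕ}
    {f : (Fin d → K) → (Fin d → K) → (Fin r → K)} (hf : IsBilin K f) (n : ℕ) :
    IsBilin K (tupleConv K f n) := by
  obtain ⟨h₁, h₂, h₃, h₄⟩ := hf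
  refine ⟨fun x x' y => ?_, fun c x y => ?_, fun x y y' => ?_, fun c x y => ?_⟩ <;> funext l <;>
    simp only [tupleConv, Pi.add_apply, Pi.smul_apply, h₁, h₂, h₃, h₄, Finset.smul_sum,
      ← Finset.sum_add_distrib] <;>
    refine Finset.sum_congr rfl fun i _ => Finset.sum_congr rfl fun j _ => ?_ <;>
    split_ifs <;> simp

/-- The identification of `K^{nd}` with `n`-tuples of vectors in `K^d`. -/
def tupleEquiv (K : Type*) [Field K] (n d : ℕ) : (Fin (n * d) → K) ≃ₗ[K] (Fin n → Fin d → K) :=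
  (LinearEquiv.funCongrLeft K K finProdFinEquiv).trans (LinearEquiv.curry K K (Fin n) (Fin d))

theorem gBil_le {K : Type*} [Field K] {d k : ℕ} {f : (Fin d → K) → (Fin d → K) → (Fin k → K)}
    (hf : IsBilin K f) (hns : Nonsingular f) : gBil K d ≤ k :=
  Nat.sInf_le ⟨f, hf, hns⟩

theorem gBil_mul_le {K : Type*} [Field K] {d r : ℕ}
    {f : (Fin d → K) → (Fin d → K) → (Fin r → K)} (hf : IsBilin K f) (hns : Nonsingular f)
    (n : ℕ) : gBil K (n * d) ≤ (2 * n - 1) * r := by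
  obtain ⟨h₁, h₂, h₃, h₄⟩ := isBilin_tupleConv hf n
  refine gBil_le (f := fun x y => (tupleEquiv K (2 * n - 1) r).symm
    (tupleConv K f n (tupleEquiv K n d x) (tupleEquiv K n d y))) ?_ fun x y h => ?_
  · refine ⟨fun x x' y => ?_, fun c x y => ?_, fun x y y' => ?_, fun c x y => ?_⟩ <;>
      simp only [map_add, map_smul, h₁, h₂, h₃, h₄]
  · simpa using nonsingular_tupleConv hf hns n _ _
      ((LinearEquiv.map_eq_zero_iff _).mp h)

/-- If `f : K^d × K^d → K^r` is a nonsingular bilinear map, then for every `n ≥ 1` the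
map `h((x₁,…,xₙ),(y₁,…,yₙ))_l = Σ_{i+j=l} f(xᵢ, yⱼ)` is nonsingular; consequently
`g_K(nd) ≤ (2n−1) g_K(d)`. -/
theorem statement_9 (K : Type*) [Field K] (d r : ℕ) (hd : 1 ≤ d) (hr : 1 ≤ r)
    (f : (Fin d → K) → (Fin d → K) → (Fin r → K))
    (hbil : IsBilin K f) (hns : Nonsingular f) (n : ℕ) (hn : 1 ≤ n) :
    Nonsingular (tupleConv K f n) ∧ gBil K (n * d) ≤ (2 * n - 1) * gBil K d := by
  obtain ⟨f₀, hf₀, hns₀⟩ : gBil K d ∈ {k | ∃ f : (Fin d → K) → (Fin d → K) → (Fin k → K),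
      IsBilin K f ∧ Nonsingular f} := Nat.sInf_mem ⟨r, f, hbil, hns⟩
  exact ⟨nonsingular_tupleConv hbil hns n, gBil_mul_le hf₀ hns₀ n⟩
end
end

section
/- Let K be an algebraically closed field and d ≥ 1. Then g_K(d) = 2d − 1; in particular, every nonsingular bilinear map f : K^d × K^d → K^k satisfies k ≥ 2d − 1. -/
noncomputable section

namespace BilinearForms

open MvPolynomial

variable {K : Type*} [Field K] {ι κ τ : Type*}

/-- The bidegree weight on `K[x_i, y_j]`: each `x_i` has weight `(1, 0)`, each `y_j` has
weight `(0, 1)`. -/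
def bidegree : ι ⊕ κ → ℕ × ℕ := Sum.elim (fun _ => (1, 0)) (fun _ => (0, 1))

variable (K ι κ) in
/-- The polynomials in `K[x_i, y_j]` that are bihomogeneous of bidegree `(n, n)`. -/
abbrev diagonalPart (n : ℕ) : Submodule K (MvPolynomial (ι ⊕ κ) K) :=
  weightedHomogeneousSubmodule K bidegree (n, n)

lemma X_mul_X_mem_diagonalPart (i : ι) (j : κ) :
    (X (Sum.inl i) * X (Sum.inr j) : MvPolynomial (ι ⊕ κ) K) ∈ diagonalPart K ι κ 1 :=
  (isWeightedHomogeneous_X K bidegree (Sum.inl i)).mul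
    (isWeightedHomogeneous_X K bidegree (Sum.inr j))

lemma mul_mem_diagonalPart {m n : ℕ} {p q : MvPolynomial (ι ⊕ κ) K}
    (hp : p ∈ diagonalPart K ι κ m) (hq : q ∈ diagonalPart K ι κ n) :
    p * q ∈ diagonalPart K ι κ (m + n) :=
  IsWeightedHomogeneous.mul hp hq

lemma weight_bidegree [Fintype ι] [Fintype κ] (e : ι ⊕ κ →₀ ℕ) :
    Finsupp.weight bidegree e = (∑ i, e (Sum.inl i), ∑ j, e (Sum.inr j)) := by
  rw [Finsupp.weight_apply, Finsupp.sum_fintype _ _ (by simp)]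
  simp [bidegree, Fintype.sum_sum_type, Prod.ext_iff, Prod.fst_sum, Prod.snd_sum]

lemma diagonalPart_fg [Finite ι] [Finite κ] (n : ℕ) : (diagonalPart K ι κ n).FG := by
  have := Fintype.ofFinite ι
  have := Fintype.ofFinite κ
  refine Submodule.FG.of_le
    (weightedHomogeneousSubmodule_fg K (fun _ : ι ⊕ κ => 1) (by simp) (n + n)) fun p hp => ?_
  intro e he
  have h := hp he
  rw [weight_bidegree, Prod.mk.injEq] at h
  rw [Finsupp.weight_apply, Finsupp.sum_fintype _ _ (by simp)]
  simp [Fintype.sum_sum_type, h.1, h.2]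

lemma weightedHomogeneousComponent_mul_of_left_mem {σ M : Type*} [AddCancelCommMonoid M]
    (w : σ → M) {a b : M} {p : MvPolynomial σ K} (hp : p ∈ weightedHomogeneousSubmodule K w a)
    (q : MvPolynomial σ K) :
    weightedHomogeneousComponent w (a + b) (p * q) = p * weightedHomogeneousComponent w b q := by
  classical
  let := weightedGradedAlgebra K w
  have h := DirectSum.coe_decompose_mul_add_of_left_mem (weightedHomogeneousSubmodule K w)
    (j := b) (b := q) hp
  rwa [← weightedDecomposition.decompose'_apply, ← weightedDecomposition.decompose'_apply]

/-- A form of bidegree `(n, n)` lies in the `n`-th power of the product of the two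
irrelevant ideals. -/
lemma diagonalPart_subset_pow [Finite ι] [Finite κ] {n : ℕ} {p : MvPolynomial (ι ⊕ κ) K}
    (hp : p ∈ diagonalPart K ι κ n) :
    p ∈ (Ideal.span (Set.range fun i : ι => (X (Sum.inl i) : MvPolynomial (ι ⊕ κ) K)) *
      Ideal.span (Set.range fun j : κ => (X (Sum.inr j) : MvPolynomial (ι ⊕ κ) K))) ^ n := by
  have := Fintype.ofFinite ι
  have := Fintype.ofFinite κ
  rw [p.as_sum]
  refine Ideal.sum_mem _ fun e he => ?_
  have h := hp (mem_support_iff.mp he)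
  rw [weight_bidegree, Prod.mk.injEq] at h
  rw [monomial_eq, Finsupp.prod_fintype _ _ (by simp), Fintype.prod_sum_type, mul_pow]
  refine Ideal.mul_mem_left _ _ (Ideal.mul_mem_mul ?_ ?_)
  · rw [← h.1, ← Finset.prod_pow_eq_pow_sum]
    exact Ideal.prod_mem_prod fun i _ =>
      Ideal.pow_mem_pow (Ideal.subset_span (Set.mem_range_self i)) _
  · rw [← h.2, ← Finset.prod_pow_eq_pow_sum]
    exact Ideal.prod_mem_prod fun j _ =>
      Ideal.pow_mem_pow (Ideal.subset_span (Set.mem_range_self j)) _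

/-- If forms `F l` of bidegree `(1, 1)` have no common zero with both blocks of coordinates
nonzero, then all forms of sufficiently large bidegree `(n, n)` lie in the ideal they
generate. -/
lemma exists_diagonalPart_le_span [IsAlgClosed K] [Finite ι] [Finite κ]
    (F : τ → MvPolynomial (ι ⊕ κ) K)
    (hF : ∀ z : ι ⊕ κ → K, (∀ l, aeval z (F l) = 0) →
      (∀ i, z (Sum.inl i) = 0) ∨ ∀ j, z (Sum.inr j) = 0) :
    ∃ N, ∀ n ≥ N, ∀ p ∈ diagonalPart K ι κ n, p ∈ Ideal.span (Set.range F) := by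
  have hrad : Ideal.span (Set.range fun i : ι => (X (Sum.inl i) : MvPolynomial (ι ⊕ κ) K)) *
      Ideal.span (Set.range fun j : κ => (X (Sum.inr j) : MvPolynomial (ι ⊕ κ) K)) ≤
      (Ideal.span (Set.range F)).radical := by
    rw [← vanishingIdeal_zeroLocus_eq_radical (K := K), Ideal.span_mul_span', Ideal.span_le]
    rintro _ ⟨_, ⟨i, rfl⟩, _, ⟨j, rfl⟩, rfl⟩
    rw [SetLike.mem_coe, mem_vanishingIdeal_iff]
    intro z hz
    rw [zeroLocus_span] at hz
    obtain h | h := hF z fun l => hz _ ⟨l, rfl⟩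
    · simp [h i]
    · simp [h j]
  obtain ⟨N, hN⟩ := Ideal.exists_pow_le_of_le_radical_of_fg hrad (IsNoetherian.noetherian _)
  exact ⟨N, fun n hn p hp => hN (Ideal.pow_le_pow_right hn (diagonalPart_subset_pow hp))⟩

/-- Under the same hypothesis, each `x_i y_j` is integral over any subalgebra containing
the forms `F l`. -/
lemma isIntegral_X_mul_X [IsAlgClosed K] [Finite ι] [Finite κ] [Finite τ]
    (F : τ → MvPolynomial (ι ⊕ κ) K) (hF₁ : ∀ l, F l ∈ diagonalPart K ι κ 1)
    (hF : ∀ z : ι ⊕ κ → K, (∀ l, aeval z (F l) = 0) →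
      (∀ i, z (Sum.inl i) = 0) ∨ ∀ j, z (Sum.inr j) = 0)
    (B : Subalgebra K (MvPolynomial (ι ⊕ κ) K)) (hB : ∀ l, F l ∈ B) (i : ι) (j : κ) :
    IsIntegral B (X (Sum.inl i) * X (Sum.inr j) : MvPolynomial (ι ⊕ κ) K) := by
  have := Fintype.ofFinite τ
  obtain ⟨N, hN⟩ := exists_diagonalPart_le_span F hF
  choose G hG using fun n => diagonalPart_fg (K := K) (ι := ι) (κ := κ) n
  let M : Submodule B (MvPolynomial (ι ⊕ κ) K) :=
    Submodule.span B (⋃ n ∈ Finset.range (N + 1), (G n : Set (MvPolynomial (ι ⊕ κ) K)))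
  have hlow : ∀ n ≤ N, ∀ p ∈ diagonalPart K ι κ n, p ∈ M := by
    intro n hn p hp
    rw [← hG] at hp
    refine Submodule.span_le_restrictScalars K B _ (Submodule.span_mono ?_ hp)
    exact Set.subset_biUnion_of_mem (u := fun n => (G n : Set (MvPolynomial (ι ⊕ κ) K)))
      (Finset.mem_coe.mpr (Finset.mem_range.mpr (Nat.lt_succ_of_le hn)))
  have hM : ∀ n, ∀ p ∈ diagonalPart K ι κ n, p ∈ M := by
    intro n
    induction n with
    | zero => exact hlow 0 N.zero_le
    | succ n ih =>
      intro p hp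
      obtain hn | hn := le_total (n + 1) N
      · exact hlow _ hn p hp
      obtain ⟨a, rfl⟩ := Ideal.mem_span_range_iff_exists_fun.mp (hN _ hn p hp)
      rw [← weightedHomogeneousComponent_eq_self hp, map_sum]
      refine Submodule.sum_mem _ fun l _ => ?_
      rw [mul_comm, show ((n + 1, n + 1) : ℕ × ℕ) = (1, 1) + (n, n) by simp [add_comm],
        weightedHomogeneousComponent_mul_of_left_mem _ (hF₁ l)]
      exact M.smul_mem ⟨F l, hB l⟩ (ih _ (weightedHomogeneousComponent_mem _ _ _))
  have hone : (1 : MvPolynomial (ι ⊕ κ) K) ∈ M := hM 0 _ (isWeightedHomogeneous_one K bidegree)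
  refine isIntegral_of_smul_mem_submodule M (fun h => ?_)
    (Submodule.fg_span ((Finset.range (N + 1)).finite_toSet.biUnion fun n _ => (G n).finite_toSet))
    _ fun p hp => ?_
  · rw [h] at hone
    exact one_ne_zero hone
  · induction hp using Submodule.span_induction with
    | mem p hp =>
      obtain ⟨n, -, hp⟩ := Set.mem_iUnion₂.mp hp
      refine hM (1 + n) _ (mul_mem_diagonalPart (X_mul_X_mem_diagonalPart i j) ?_)
      exact hG n ▸ Submodule.subset_span hp
    | zero => simp
    | add p q _ _ hp hq => rw [smul_add]; exact M.add_mem hp hq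
    | smul b p _ hp => rw [smul_comm]; exact M.smul_mem b hp

/-- Under the same hypothesis, there are at least `|ι| + |κ| - 1` forms `F l`: together with
one variable they generate a subalgebra over which all of `K[x_i, y_j]` is algebraic. -/
theorem card_add_card_le [IsAlgClosed K] [Fintype ι] [Fintype κ] [Fintype τ]
    [Nonempty ι] [Nonempty κ]
    (F : τ → MvPolynomial (ι ⊕ κ) K) (hF₁ : ∀ l, F l ∈ diagonalPart K ι κ 1)
    (hF : ∀ z : ι ⊕ κ → K, (∀ l, aeval z (F l) = 0) →
      (∀ i, z (Sum.inl i) = 0) ∨ ∀ j, z (Sum.inr j) = 0) :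
    Fintype.card ι + Fintype.card κ ≤ Fintype.card τ + 1 := by
  classical
  obtain ⟨i₀⟩ := ‹Nonempty ι›
  obtain ⟨j₀⟩ := ‹Nonempty κ›
  let y₀ : MvPolynomial (ι ⊕ κ) K := X (Sum.inr j₀)
  let s : Finset (MvPolynomial (ι ⊕ κ) K) := insert y₀ (Finset.univ.image F)
  let D := Algebra.adjoin K (s : Set (MvPolynomial (ι ⊕ κ) K))
  have hxy (i : ι) (j : κ) :
      IsAlgebraic D (X (Sum.inl i) * X (Sum.inr j) : MvPolynomial (ι ⊕ κ) K) :=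
    (isIntegral_X_mul_X F hF₁ hF D
      (fun l => Algebra.subset_adjoin (by simp [s])) i j).isAlgebraic
  have hy₀ : IsAlgebraic D y₀ :=
    isAlgebraic_algebraMap (⟨y₀, Algebra.subset_adjoin (by simp [s])⟩ : D)
  have hx (i : ι) : IsAlgebraic D (X (Sum.inl i) : MvPolynomial (ι ⊕ κ) K) :=
    .of_mul (mem_nonZeroDivisors_of_ne_zero (X_ne_zero _)) hy₀ (mul_comm y₀ _ ▸ hxy i j₀)
  have hy (j : κ) : IsAlgebraic D (X (Sum.inr j) : MvPolynomial (ι ⊕ κ) K) :=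
    .of_mul (mem_nonZeroDivisors_of_ne_zero (X_ne_zero _)) (hx i₀) (hxy i₀ j)
  have hD : Algebra.IsAlgebraic D (MvPolynomial (ι ⊕ κ) K) := by
    refine ⟨fun p => ?_⟩
    induction p using MvPolynomial.induction_on with
    | C a => exact isAlgebraic_algebraMap (algebraMap K D a)
    | add p q hp hq => exact hp.add hq
    | mul_X p v hp => exact hp.mul (v.rec hx hy)
  have h := Algebra.IsAlgebraic.trdeg_le_cardinalMk K (s : Set (MvPolynomial (ι ⊕ κ) K))
  rw [MvPolynomial.trdeg_of_isDomain] at h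
  have h' : Fintype.card ι + Fintype.card κ ≤ s.card := by
    simpa [← Nat.cast_add, -Nat.cast_add, Cardinal.mk_coe_finset] using h
  exact h'.trans ((Finset.card_insert_le _ _).trans (Nat.succ_le_succ Finset.card_image_le))

/-- Over an algebraically closed field, a nonsingular bilinear map `K^ι × K^κ → K^τ` with
`ι`, `κ` nonempty satisfies `|ι| + |κ| - 1 ≤ |τ|`. -/
theorem card_add_card_le_of_nonsingular [IsAlgClosed K] [Fintype ι] [Fintype κ] [Fintype τ]
    [Nonempty ι] [Nonempty κ] (f : (ι → K) → (κ → K) → (τ → K))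
    (hf : IsBilin K f) (hns : Nonsingular f) :
    Fintype.card ι + Fintype.card κ ≤ Fintype.card τ + 1 := by
  classical
  let g : (ι → K) →ₗ[K] (κ → K) →ₗ[K] (τ → K) :=
    LinearMap.mk₂ K f hf.1 hf.2.1 hf.2.2.1 hf.2.2.2
  let F (l : τ) : MvPolynomial (ι ⊕ κ) K :=
    ∑ i, ∑ j, C (f (Pi.single i 1) (Pi.single j 1) l) * (X (Sum.inl i) * X (Sum.inr j))
  refine card_add_card_le F (fun l => ?_) fun z hz => ?_
  · refine Submodule.sum_mem _ fun i _ => Submodule.sum_mem _ fun j _ => ?_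
    rw [← smul_eq_C_mul]
    exact Submodule.smul_mem _ _ (X_mul_X_mem_diagonalPart i j)
  · have hfz : f (fun i => z (Sum.inl i)) (fun j => z (Sum.inr j)) = 0 := by
      change g _ _ = 0
      rw [pi_eq_sum_univ' (fun i => z (Sum.inl i)), pi_eq_sum_univ' (fun j => z (Sum.inr j))]
      ext l
      rw [Pi.zero_apply, ← hz l]
      simp only [g, F, map_sum, LinearMap.sum_apply, Finset.sum_apply, map_smul,
        LinearMap.smul_apply, Pi.smul_apply, LinearMap.mk₂_apply, map_mul, aeval_C, aeval_X,
        Algebra.algebraMap_self_apply, smul_eq_mul]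
      simp only [Finset.mul_sum]
      rw [Finset.sum_comm]
      exact Finset.sum_congr rfl fun i _ => Finset.sum_congr rfl fun j _ => by ring
    exact (hns _ _ hfz).imp congrFun congrFun

end BilinearForms

open Polynomial in
/-- Multiplication of polynomials of degree less than `d` is a nonsingular bilinear map
`K^d × K^d → K^(2d - 1)`. -/
theorem exists_nonsingular_bilin_two_mul_sub_one (K : Type*) [Field K] {d : ℕ} (hd : 1 ≤ d) :
    ∃ f : (Fin d → K) → (Fin d → K) → (Fin (2 * d - 1) → K), IsBilin K f ∧ Nonsingular f := by
  let e := (degreeLTEquiv K d).symm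
  refine ⟨fun x y n => ((e x : K[X]) * (e y : K[X])).coeff n, ⟨?_, ?_, ?_, ?_⟩, fun x y h => ?_⟩
  · intros; ext; simp [add_mul]
  · intros; ext; simp
  · intros; ext; simp [mul_add]
  · intros; ext; simp
  · have hdeg (x : Fin d → K) : (e x : K[X]).natDegree < d := by
      by_cases h0 : (e x : K[X]) = 0
      · rwa [h0, natDegree_zero]
      · exact (natDegree_lt_iff_degree_lt h0).mpr (mem_degreeLT.mp (e x).2)
    have h0 : (e x : K[X]) * (e y : K[X]) = 0 := by
      ext n
      by_cases hn : n < 2 * d - 1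
      · exact congrFun h ⟨n, hn⟩
      · refine coeff_eq_zero_of_natDegree_lt (natDegree_mul_le.trans_lt ?_)
        have := hdeg x
        have := hdeg y
        omega
    simpa using mul_eq_zero.mp h0

/-- For an algebraically closed field `K`, `g_K(d) = 2d − 1`; in particular every
nonsingular bilinear map `f : K^d × K^d → K^k` satisfies `k ≥ 2d − 1`. -/
theorem statement_10 (K : Type*) [Field K] [IsAlgClosed K] (d : ℕ) (hd : 1 ≤ d) :
    gBil K d = 2 * d - 1 ∧
      ∀ (k : ℕ) (f : (Fin d → K) → (Fin d → K) → (Fin k → K)),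
        IsBilin K f → Nonsingular f → 2 * d - 1 ≤ k := by
  have hle : ∀ (k : ℕ) (f : (Fin d → K) → (Fin d → K) → (Fin k → K)),
      IsBilin K f → Nonsingular f → 2 * d - 1 ≤ k := by
    intro k f hf hns
    have : Nonempty (Fin d) := ⟨⟨0, hd⟩⟩
    have h := BilinearForms.card_add_card_le_of_nonsingular f hf hns
    simp only [Fintype.card_fin] at h
    omega
  refine ⟨le_antisymm (Nat.sInf_le (exists_nonsingular_bilin_two_mul_sub_one K hd)) ?_, hle⟩
  refine le_csInf ⟨_, exists_nonsingular_bilin_two_mul_sub_one K hd⟩ ?_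
  rintro k ⟨f, hf, hns⟩
  exact hle k f hf hns
end
end

section
/- For every integer d ≥ 2 there exists a nonsingular bilinear map f : ℝ^d × ℝ^d → ℝ^{2d−2}; that is, g_ℝ(d) ≤ 2d − 2. -/
noncomputable section

open Polynomial

/-- If all roots of `p` are `n`-th roots of `A`, then the `n`-th power of the constant coefficient
is determined by `A`, the degree and the leading coefficient. -/
theorem Polynomial.coeff_zero_pow_of_roots {K : Type*} [Field K] [IsAlgClosed K] (p : K[X])
    (n : ℕ) (A : K) (h : ∀ z ∈ p.roots, z ^ n = A) :
    p.coeff 0 ^ n = ((-1) ^ p.natDegree * p.leadingCoeff) ^ n * A ^ p.natDegree := by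
  have hs : p.Splits := IsAlgClosed.splits p
  have hprod : p.roots.prod ^ n = A ^ p.natDegree := by
    rw [← Multiset.map_id p.roots, ← Multiset.prod_map_pow]
    simp only [id]
    rw [Multiset.map_congr rfl h, Multiset.map_const', Multiset.prod_replicate,
      hs.natDegree_eq_card_roots]
  rw [hs.coeff_zero_eq_leadingCoeff_mul_prod_roots, mul_pow, hprod]

/-- A nonsingular bilinear map can be transported to coordinates. -/
theorem IsBilin.exists_coordinates {K E G : Type*} [Field K] [AddCommGroup E] [AddCommGroup G]
    [Module K E] [Module K G] [FiniteDimensional K E] [FiniteDimensional K G]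
    {f : E → E → G} (hf : IsBilin K f) (hn : Nonsingular f) {d k : ℕ}
    (hd : Module.finrank K E = d) (hk : Module.finrank K G = k) :
    ∃ g : (Fin d → K) → (Fin d → K) → (Fin k → K), IsBilin K g ∧ Nonsingular g := by
  let e : (Fin d → K) ≃ₗ[K] E := LinearEquiv.ofFinrankEq _ _ (by simp [hd])
  let u : G ≃ₗ[K] (Fin k → K) := LinearEquiv.ofFinrankEq _ _ (by simp [hk])
  obtain ⟨h₁, h₂, h₃, h₄⟩ := hf
  refine ⟨fun x y ↦ u (f (e x) (e y)), ⟨?_, ?_, ?_, ?_⟩, ?_⟩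
  · simp [h₁]
  · simp [h₂]
  · simp [h₃]
  · simp [h₄]
  · intro x y hxy
    simpa using hn _ _ (u.map_eq_zero_iff.mp hxy)

/-- Multiplication of complex polynomials of degree less than `n`, in coefficients. -/
def polyMul (n : ℕ) (x y : Fin n → ℂ) : Fin (2 * n - 1) → ℂ :=
  fun k ↦ (ofFn n x * ofFn n y).coeff k

theorem isBilin_polyMul (n : ℕ) : IsBilin ℝ (polyMul n) := by
  refine ⟨?_, ?_, ?_, ?_⟩ <;> intros <;> ext k <;>
    simp [polyMul, LinearMap.map_smul_of_tower, add_mul, mul_add]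

theorem nonsingular_polyMul {n : ℕ} (hn : 1 ≤ n) : Nonsingular (polyMul n) := by
  intro x y h
  have hx := ofFn_natDegree_lt hn x
  have hy := ofFn_natDegree_lt hn y
  have hz : ofFn n x * ofFn n y = 0 := by
    ext k
    by_cases hk : k < 2 * n - 1
    · exact congrFun h ⟨k, hk⟩
    · exact coeff_eq_zero_of_natDegree_lt (natDegree_mul_le.trans_lt (by lia))
  simpa [(injective_ofFn n).eq_iff' (map_zero _)] using hz

/-- The polynomial `a + v₀ X + ⋯ + vₙ₋₁ Xⁿ` with real constant coefficient. -/
def realConstPoly (n : ℕ) (x : ℝ × (Fin n → ℂ)) : ℂ[X] :=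
  C (x.1 : ℂ) + X * ofFn n x.2

section realConstPoly

variable {n : ℕ}

theorem realConstPoly_add (x y : ℝ × (Fin n → ℂ)) :
    realConstPoly n (x + y) = realConstPoly n x + realConstPoly n y := by
  simp [realConstPoly]; ring

theorem realConstPoly_smul (c : ℝ) (x : ℝ × (Fin n → ℂ)) :
    realConstPoly n (c • x) = c • realConstPoly n x := by
  ext k
  simp [realConstPoly, LinearMap.map_smul_of_tower, coeff_C]

@[simp]
theorem coeff_realConstPoly_zero (x : ℝ × (Fin n → ℂ)) : (realConstPoly n x).coeff 0 = x.1 := by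
  simp [realConstPoly]

theorem natDegree_realConstPoly_le (x : ℝ × (Fin n → ℂ)) : (realConstPoly n x).natDegree ≤ n := by
  rw [natDegree_le_iff_coeff_eq_zero]
  intro k hk
  obtain ⟨j, rfl⟩ : ∃ j, k = j + 1 := ⟨k - 1, by lia⟩
  rw [realConstPoly, coeff_add, coeff_X_mul, coeff_C_succ, zero_add,
    ofFn_coeff_eq_zero_of_ge _ (by lia)]

theorem realConstPoly_eq_zero {x : ℝ × (Fin n → ℂ)} (h : realConstPoly n x = 0) : x = 0 := by
  have h0 : x.1 = 0 := by simpa [h] using (coeff_realConstPoly_zero x).symm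
  have h1 : ofFn n x.2 = 0 := by simpa [realConstPoly, h0] using h
  exact Prod.ext h0 ((injective_ofFn n).eq_iff' (map_zero _) |>.mp h1)

end realConstPoly

open ComplexConjugate

/-- Multiplication of polynomials with real constant coefficients, in which the top coefficient
is not recorded but is added, after a twist by conjugation and `κ`, to the constant one. -/
def twistedMul (κ : ℂ) (n : ℕ) (x y : ℝ × (Fin n → ℂ)) : Fin (2 * n) → ℂ :=
  fun k ↦ (realConstPoly n x * realConstPoly n y).coeff k +
    if (k : ℕ) = 0 then κ * ((realConstPoly n x).coeff n * conj ((realConstPoly n y).coeff n))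
    else 0

theorem isBilin_twistedMul (κ : ℂ) (n : ℕ) : IsBilin ℝ (twistedMul κ n) := by
  refine ⟨?_, ?_, ?_, ?_⟩ <;> intros <;> ext k <;>
    simp only [twistedMul, realConstPoly_add, realConstPoly_smul, Pi.add_apply, Pi.smul_apply,
      add_mul, mul_add, smul_mul_assoc, mul_smul_comm, coeff_add, coeff_smul, map_add,
      Complex.real_smul, map_mul, Complex.conj_ofReal] <;>
    split_ifs <;> ring

/-- Suppose `p q = r + s X²ⁿ`, where `p`, `q` have real constant coefficients and `n`-th
coefficients `z`, `w`. If `r + κ z w̄ = 0` with `κⁿ = -1`, then `s = z w` vanishes. -/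
theorem mul_coeff_eq_zero_of_twisted {κ : ℂ} {n : ℕ} (hκ : κ ^ n = -1) (hn : n ≠ 0) {p q : ℂ[X]}
    (hp : p.natDegree ≤ n) {a b : ℝ} (ha : p.coeff 0 = a) (hb : q.coeff 0 = b)
    (hpq : p * q = C (p.coeff 0 * q.coeff 0) + C (p.coeff n * q.coeff n) * X ^ (2 * n))
    (h : p.coeff 0 * q.coeff 0 + κ * (p.coeff n * conj (q.coeff n)) = 0) :
    p.coeff n * q.coeff n = 0 := by
  by_contra hne
  obtain ⟨hz, hw⟩ := mul_ne_zero_iff.mp hne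
  have hdeg : p.natDegree = n := le_antisymm hp (le_natDegree_of_ne_zero hz)
  have hlc : p.leadingCoeff = p.coeff n := by rw [leadingCoeff, hdeg]
  have hp0 : p ≠ 0 := by rintro rfl; simp at hz
  rw [ha, hb] at hpq h
  generalize p.coeff n = z at *
  generalize q.coeff n = w at *
  have hroot : ∀ t ∈ p.roots, t ^ (2 * n) = κ * conj w / w := by
    intro t ht
    have ht' : p.eval t = 0 := (mem_roots hp0).mp ht
    have e := congrArg (eval t) hpq
    simp only [eval_mul, ht', zero_mul, eval_add, eval_C, eval_pow, eval_X] at e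
    rw [eq_div_iff hw]
    apply mul_left_cancel₀ hz
    linear_combination -h - e
  have key := p.coeff_zero_pow_of_roots _ _ hroot
  rw [hdeg, hlc, ha, div_pow, mul_pow κ, hκ, mul_pow, ← pow_mul, mul_left_comm n 2 n,
    pow_mul (-1 : ℂ) 2, neg_one_sq, one_pow, one_mul, mul_div_assoc', eq_div_iff (pow_ne_zero _ hw)]
    at key
  have hκ0 : κ ≠ 0 := by rintro rfl; simp [hn] at hκ
  have hzw : (z * conj w) ^ n = -(-(a * b : ℂ)) ^ n := by
    have : (κ * (z * conj w)) ^ n = (-(a * b : ℂ)) ^ n := by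
      congr 1; linear_combination h
    rw [mul_pow, hκ] at this
    linear_combination -this
  have hzw' : (conj z * w) ^ n = -(-(a * b : ℂ)) ^ n := by
    simpa using congrArg conj hzw
  have hab : (-(a * b : ℂ)) ^ n ≠ 0 := by
    have : (z * conj w) ^ n ≠ 0 := pow_ne_zero _ (mul_ne_zero hz (by simpa using hw))
    rw [hzw] at this
    exact neg_ne_zero.mp this
  have hsum : (a : ℂ) ^ (2 * n) + (z * conj z) ^ n = 0 := by
    apply mul_right_cancel₀ hab
    rw [mul_pow] at hzw hzw' ⊢
    rw [mul_comm 2 n, pow_mul z] at key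
    linear_combination (-conj z ^ n) * key + (a : ℂ) ^ (2 * n) * hzw' + z ^ n * conj z ^ n * hzw
  rw [Complex.mul_conj] at hsum
  norm_cast at hsum
  have h1 : 0 < Complex.normSq z ^ n := pow_pos (Complex.normSq_pos.mpr hz) n
  have h2 : 0 ≤ a ^ (2 * n) := by rw [pow_mul]; positivity
  linarith

theorem nonsingular_twistedMul {κ : ℂ} {n : ℕ} (hκ : κ ^ n = -1) (hn : n ≠ 0) :
    Nonsingular (twistedMul κ n) := by
  intro x y h
  have hp := natDegree_realConstPoly_le x
  have hq := natDegree_realConstPoly_le y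
  have ha := coeff_realConstPoly_zero x
  have hb := coeff_realConstPoly_zero y
  have hmid : ∀ k, k ≠ 0 → k < 2 * n →
      (realConstPoly n x * realConstPoly n y).coeff k = 0 := by
    intro k hk hk'
    simpa [twistedMul, hk] using congrFun h ⟨k, hk'⟩
  have hzero := congrFun h ⟨0, by lia⟩
  suffices realConstPoly n x * realConstPoly n y = 0 from
    (mul_eq_zero.mp this).imp realConstPoly_eq_zero realConstPoly_eq_zero
  simp only [twistedMul, if_true, Pi.zero_apply, mul_coeff_zero] at hzero
  generalize realConstPoly n x = p at *
  generalize realConstPoly n y = q at *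
  have hpq : p * q = C (p.coeff 0 * q.coeff 0) + C (p.coeff n * q.coeff n) * X ^ (2 * n) := by
    ext k
    rcases eq_or_ne k 0 with rfl | hk
    · simp [hn]
    rw [coeff_add, coeff_C_of_ne_zero hk, coeff_C_mul, coeff_X_pow, zero_add]
    rcases lt_trichotomy k (2 * n) with hlt | rfl | hgt
    · simp [hmid k hk hlt, hlt.ne]
    · rw [if_pos rfl, mul_one, two_mul, coeff_mul_add_eq_of_natDegree_le hp hq]
    · rw [if_neg hgt.ne', mul_zero]
      exact coeff_eq_zero_of_natDegree_lt (natDegree_mul_le.trans_lt (by lia))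
  have hs := mul_coeff_eq_zero_of_twisted hκ hn hp ha hb hpq hzero
  have hr : p.coeff 0 * q.coeff 0 = 0 := by
    rcases mul_eq_zero.mp hs with h0 | h0 <;> simpa [h0] using hzero
  rw [hpq, hs, hr]
  simp

/-- For every `d ≥ 2` there exists a nonsingular bilinear map
`ℝ^d × ℝ^d → ℝ^{2d−2}`; that is, `g_ℝ(d) ≤ 2d − 2`. -/
theorem statement_11 (d : ℕ) (hd : 2 ≤ d) :
    (∃ f : (Fin d → ℝ) → (Fin d → ℝ) → (Fin (2 * d - 2) → ℝ),
      IsBilin ℝ f ∧ Nonsingular f) ∧ gBil ℝ d ≤ 2 * d - 2 := by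
  suffices H : ∃ f : (Fin d → ℝ) → (Fin d → ℝ) → (Fin (2 * d - 2) → ℝ),
      IsBilin ℝ f ∧ Nonsingular f from ⟨H, Nat.sInf_le H⟩
  obtain ⟨n, rfl | rfl⟩ := Nat.even_or_odd' d
  · refine (isBilin_polyMul n).exists_coordinates (nonsingular_polyMul (by lia)) ?_ ?_ <;>
      simp [Module.finrank_pi_fintype, Complex.finrank_real_complex] <;> lia
  · have hn : n ≠ 0 := by lia
    obtain ⟨κ, hκ⟩ := IsAlgClosed.exists_pow_nat_eq (-1 : ℂ) (Nat.pos_of_ne_zero hn)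
    refine (isBilin_twistedMul κ n).exists_coordinates (nonsingular_twistedMul hκ hn) ?_ ?_ <;>
      simp [Module.finrank_pi_fintype, Complex.finrank_real_complex] <;> lia
end
end
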